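/- arXiv:math/0105016 — 4 statements merged into one kernel-verified Lean document; each statement's English description precedes it below -/
import Mathlib

section
/- (Uniqueness of the Poincaré metric) Let Ω ⊆ ℂ be a nonempty open connected set, and let u, v : Ω → ℝ be C² functions with Δu = e^{2u} and Δv = e^{2v} on Ω, such that both u and v are complete, i.e. for every continuous piecewise-C¹ path γ : [0,1) → Ω that eventually leaves every compact subset of Ω, both ∫₀¹ e^{u(γ(t))}|γ'(t)| dt and ∫₀¹ e^{v(γ(t))}|γ'(t)| dt are infinite. Then u = v on Ω. -/
/-- The Euclidean Laplacian of `u : ℂ → ℝ` on an (open) set `s`, computed via second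
derivatives within `s` in the directions `1` and `I`. -/
noncomputable def laplacianOn (u : ℂ → ℝ) (s : Set ℂ) (z : ℂ) : ℝ :=
  iteratedFDerivWithin ℝ 2 u s z ![1, 1] +
    iteratedFDerivWithin ℝ 2 u s z ![Complex.I, Complex.I]

/-- The conformal metric `e^{2u}|dz|²` on `Ω` is complete: every continuous,
piecewise-C¹ path `γ : [0,1) → Ω` that eventually leaves every compact subset of `Ω`
has infinite length `∫₀¹ e^{u(γ t)} |γ'(t)| dt`. -/
def ConformallyComplete (u : ℂ → ℝ) (Ω : Set ℂ) : Prop :=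
  ∀ γ : ℝ → ℂ,
    ContinuousOn γ (Set.Ico 0 1) →
    (∀ t ∈ Set.Ico (0 : ℝ) 1, γ t ∈ Ω) →
    (∀ s ∈ Set.Ico (0 : ℝ) 1, ∃ n : ℕ, ∃ τ : Fin (n + 1) → ℝ,
      Monotone τ ∧ τ 0 = 0 ∧ τ (Fin.last n) = s ∧
      ∀ i : Fin n, ContDiffOn ℝ 1 γ (Set.Icc (τ i.castSucc) (τ i.succ))) →
    (∀ K : Set ℂ, IsCompact K → K ⊆ Ω →
      ∃ T, 0 ≤ T ∧ T < 1 ∧ ∀ t, T ≤ t → t < 1 → γ t ∉ K) →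
    ∫⁻ t in Set.Ioo (0 : ℝ) 1, ENNReal.ofReal (Real.exp (u (γ t)) * ‖deriv γ t‖) = ⊤

open Filter Topology

/-- `f` is differentiable near `0`, with `f' 0 = b` and `f'' 0 = c`. -/
def HasJet (f : ℝ → ℝ) (b c : ℝ) : Prop :=
  ∃ f' : ℝ → ℝ, (∀ᶠ s in 𝓝 (0 : ℝ), HasDerivAt f (f' s) s) ∧ f' 0 = b ∧ HasDerivAt f' c 0

namespace HasJet

variable {f g : ℝ → ℝ} {b c b₁ c₁ : ℝ}

theorem continuousAt (hf : HasJet f b c) : ContinuousAt f 0 := by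
  obtain ⟨f', h1, -, -⟩ := hf
  exact h1.self_of_nhds.continuousAt

theorem const (k : ℝ) : HasJet (fun _ => k) 0 0 :=
  ⟨fun _ => 0, Eventually.of_forall fun s => hasDerivAt_const s k, rfl, hasDerivAt_const 0 0⟩

theorem add (hf : HasJet f b c) (hg : HasJet g b₁ c₁) :
    HasJet (fun s => f s + g s) (b + b₁) (c + c₁) := by
  obtain ⟨f', h1, h2, h3⟩ := hf
  obtain ⟨g', k1, k2, k3⟩ := hg
  refine ⟨fun s => f' s + g' s, ?_, by simp only [h2, k2], h3.add k3⟩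
  filter_upwards [h1, k1] with s hs ks using hs.add ks

theorem const_mul (k : ℝ) (hf : HasJet f b c) : HasJet (fun s => k * f s) (k * b) (k * c) := by
  obtain ⟨f', h1, h2, h3⟩ := hf
  refine ⟨fun s => k * f' s, ?_, by simp only [h2], h3.const_mul k⟩
  filter_upwards [h1] with s hs using hs.const_mul k

theorem sub (hf : HasJet f b c) (hg : HasJet g b₁ c₁) :
    HasJet (fun s => f s - g s) (b - b₁) (c - c₁) := by
  simpa [sub_eq_add_neg] using hf.add (hg.const_mul (-1))

theorem sum {ι : Type*} (t : Finset ι) {F : ι → ℝ → ℝ} {B C : ι → ℝ}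
    (h : ∀ i ∈ t, HasJet (F i) (B i) (C i)) :
    HasJet (fun s => ∑ i ∈ t, F i s) (∑ i ∈ t, B i) (∑ i ∈ t, C i) := by
  classical
  induction t using Finset.induction_on with
  | empty => simpa using HasJet.const 0
  | insert i t hi ih =>
    simp only [Finset.sum_insert hi]
    exact (h i (by simp)).add (ih fun j hj => h j (by simp [hj]))

theorem mul (hf : HasJet f b c) (hg : HasJet g b₁ c₁) :
    HasJet (fun s => f s * g s) (b * g 0 + f 0 * b₁) (c * g 0 + 2 * b * b₁ + f 0 * c₁) := by
  obtain ⟨f', h1, h2, h3⟩ := hf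
  obtain ⟨g', k1, k2, k3⟩ := hg
  refine ⟨fun s => f' s * g s + f s * g' s, ?_, by simp only [h2, k2], ?_⟩
  · filter_upwards [h1, k1] with s hs ks using hs.mul ks
  · refine ((h3.mul k1.self_of_nhds).add (h1.self_of_nhds.mul k3)).congr_deriv ?_
    rw [h2, k2]; ring

theorem exp (hf : HasJet f b c) :
    HasJet (fun s => Real.exp (f s)) (Real.exp (f 0) * b) (Real.exp (f 0) * (b ^ 2 + c)) := by
  obtain ⟨f', h1, h2, h3⟩ := hf
  refine ⟨fun s => Real.exp (f s) * f' s, ?_, by simp only [h2], ?_⟩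
  · filter_upwards [h1] with s hs using hs.exp
  · refine (h1.self_of_nhds.exp.mul h3).congr_deriv ?_
    rw [h2]; ring

theorem log (hf : HasJet f b c) (h0 : 0 < f 0) :
    HasJet (fun s => Real.log (f s)) (b / f 0) (c / f 0 - b ^ 2 / f 0 ^ 2) := by
  have hc := hf.continuousAt
  obtain ⟨f', h1, h2, h3⟩ := hf
  refine ⟨fun s => f' s / f s, ?_, by simp only [h2], ?_⟩
  · filter_upwards [h1, hc.eventually (lt_mem_nhds h0)] with s hs ks using hs.log ks.ne'
  · refine (h3.div h1.self_of_nhds h0.ne').congr_deriv ?_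
    rw [h2]; field_simp

/-- First and second order conditions at a local maximum. -/
theorem of_isLocalMax (hf : HasJet f b c) (h : IsLocalMax f 0) : b = 0 ∧ c ≤ 0 := by
  obtain ⟨f', h1, h2, h3⟩ := hf
  have hb : b = 0 := by rw [← h2]; exact h.hasDerivAt_eq_zero h1.self_of_nhds
  refine ⟨hb, ?_⟩
  by_contra! hc
  have hd : deriv f =ᶠ[𝓝 0] f' := by
    filter_upwards [h1] with s hs using hs.deriv
  have hdd : deriv (deriv f) 0 = c := by rw [hd.deriv_eq]; exact h3.deriv
  have hmin : IsLocalMin f 0 := isLocalMin_of_deriv_deriv_pos (by rw [hdd]; exact hc)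
    (by rw [hd.self_of_nhds, h2, hb]) h1.self_of_nhds.continuousAt
  have hconst : f =ᶠ[𝓝 0] fun _ => f 0 := by
    filter_upwards [h, hmin] with s h1 h2 using le_antisymm h1 h2
  have : deriv (deriv f) 0 = 0 := by
    rw [(hconst.deriv).deriv_eq]; simp
  linarith

theorem line {v : ℂ → ℝ} {z : ℂ} (hv : ContDiffAt ℝ 2 v z) (X : ℂ) :
    HasJet (fun s => v (z + s • X)) (fderiv ℝ v z X) (fderiv ℝ (fderiv ℝ v) z X X) := by
  have hl : ∀ s : ℝ, HasDerivAt (fun s : ℝ => z + s • X) X s := fun s => by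
    simpa using ((hasDerivAt_id s).smul_const X).const_add z
  have hz : z + (0 : ℝ) • X = z := by simp
  refine ⟨fun s => fderiv ℝ v (z + s • X) X, ?_, by simp, ?_⟩
  · have h1 : ∀ᶠ y in 𝓝 z, ContDiffAt ℝ 2 v y := hv.eventually (by simp)
    have h2 : Tendsto (fun s : ℝ => z + s • X) (𝓝 0) (𝓝 z) := by
      have := (hl 0).continuousAt
      rwa [ContinuousAt, hz] at this
    filter_upwards [h2.eventually h1] with s hs
    exact (hs.differentiableAt (by simp)).hasFDerivAt.comp_hasDerivAt s (hl s)
  · have h1 : ContDiffAt ℝ 1 (fderiv ℝ v) z := hv.fderiv_right (by norm_num)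
    have h2 := (h1.differentiableAt (by simp)).hasFDerivAt
    rw [← hz] at h2
    have h3 := h2.comp_hasDerivAt (0 : ℝ) (hl 0)
    simp only [zero_smul, add_zero] at h3
    have h4 := h3.clm_apply (hasDerivAt_const (0 : ℝ) X)
    simpa using h4

theorem normSq_line (a b : ℂ) :
    HasJet (fun s => Complex.normSq (a + s • b))
      (2 * (a.re * b.re + a.im * b.im)) (2 * Complex.normSq b) := by
  refine ⟨fun s => 2 * (a.re * b.re + a.im * b.im) + s * (2 * Complex.normSq b), ?_, by simp, ?_⟩
  · refine Eventually.of_forall fun s => ?_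
    have h : (fun s : ℝ => Complex.normSq (a + s • b)) = fun s : ℝ =>
        (a.re + s * b.re) * (a.re + s * b.re) + (a.im + s * b.im) * (a.im + s * b.im) := by
      funext s; simp [Complex.normSq_apply]
    rw [h]
    have h1 : HasDerivAt (fun s : ℝ => a.re + s * b.re) b.re s := by
      simpa using ((hasDerivAt_id s).mul_const b.re).const_add a.re
    have h2 : HasDerivAt (fun s : ℝ => a.im + s * b.im) b.im s := by
      simpa using ((hasDerivAt_id s).mul_const b.im).const_add a.im
    refine ((h1.mul h1).add (h2.mul h2)).congr_deriv ?_
    rw [Complex.normSq_apply]; ring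
  · simpa using ((hasDerivAt_id (0 : ℝ)).mul_const (2 * Complex.normSq b)).const_add
      (2 * (a.re * b.re + a.im * b.im))

end HasJet

/-- The Wirtinger-type gradient: `fderiv ℝ v z h = Re (cgrad v z * h)`. -/
noncomputable def cgrad (v : ℂ → ℝ) (z : ℂ) : ℂ :=
  ⟨fderiv ℝ v z 1, -fderiv ℝ v z Complex.I⟩

theorem fderiv_eq_re_cgrad (v : ℂ → ℝ) (z h : ℂ) : fderiv ℝ v z h = (cgrad v z * h).re := by
  have hh : h = h.re • (1 : ℂ) + h.im • Complex.I := by simp [Complex.re_add_im]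
  conv_lhs => rw [hh]
  rw [map_add, map_smul, map_smul]
  simp [cgrad]; ring

theorem continuousOn_cgrad {v : ℂ → ℝ} {Ω : Set ℂ} (hopen : IsOpen Ω)
    (hv : ContDiffOn ℝ 2 v Ω) : ContinuousOn (cgrad v) Ω := by
  have h : ContinuousOn (fderiv ℝ v) Ω := hv.continuousOn_fderiv_of_isOpen hopen (by norm_num)
  have h1 : ContinuousOn (fun z => fderiv ℝ v z 1) Ω := h.clm_apply continuousOn_const
  have h2 : ContinuousOn (fun z => fderiv ℝ v z Complex.I) Ω := h.clm_apply continuousOn_const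
  have : cgrad v = fun z => ((fderiv ℝ v z 1 : ℝ) : ℂ) - (fderiv ℝ v z Complex.I : ℝ) * Complex.I := by
    funext z
    apply Complex.ext <;> simp [cgrad]
  rw [this]
  exact (Complex.continuous_ofReal.comp_continuousOn h1).sub
    ((Complex.continuous_ofReal.comp_continuousOn h2).mul continuousOn_const)

theorem laplacianOn_eq {v : ℂ → ℝ} {Ω : Set ℂ} (hopen : IsOpen Ω) {z : ℂ} (hz : z ∈ Ω) :
    laplacianOn v Ω z = fderiv ℝ (fderiv ℝ v) z 1 1 +
      fderiv ℝ (fderiv ℝ v) z Complex.I Complex.I := by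
  rw [laplacianOn, iteratedFDerivWithin_of_isOpen 2 hopen hz]
  simp [iteratedFDeriv_two_apply]

/-- The Laplacian is conformally covariant under complex-linear changes of variable. -/
theorem bilin_add_rotate (B : ℂ →L[ℝ] ℂ →L[ℝ] ℝ) (X : ℂ) :
    B X X + B (Complex.I * X) (Complex.I * X) =
      Complex.normSq X * (B 1 1 + B Complex.I Complex.I) := by
  have h1 : X = X.re • (1 : ℂ) + X.im • Complex.I := by simp [Complex.re_add_im]
  have h2 : Complex.I * X = (-X.im) • (1 : ℂ) + X.re • Complex.I := by
    apply Complex.ext <;> simp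
  rw [h2]
  conv_lhs => rw [h1]
  simp only [map_add, map_smul, add_apply, smul_apply,
    smul_eq_mul, Complex.normSq_apply]
  simp
  ring

/-- Value of the second-order expansion of one summand `e^{2v}|Δz|²` of the discrete energy. -/
theorem exists_jet_energy_term {v : ℂ → ℝ} {z : ℂ} (hv : ContDiffAt ℝ 2 v z) (a X b : ℂ) :
    ∃ C : ℝ, HasJet (fun s => Real.exp (2 * v (z + s • X)) * Complex.normSq (a + s • b))
      (2 * Real.exp (2 * v z) * (starRingEnd ℂ a * (cgrad v z * X * a + b)).re) C ∧
      C = Real.exp (2 * v z) * (2 * fderiv ℝ (fderiv ℝ v) z X X * Complex.normSq a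
        + 4 * (cgrad v z * X).re ^ 2 * Complex.normSq a
        + 8 * (cgrad v z * X).re * (starRingEnd ℂ a * b).re + 2 * Complex.normSq b) := by
  have h := (((HasJet.line hv X).const_mul 2).exp).mul (HasJet.normSq_line a b)
  simp only [zero_smul, add_zero, fderiv_eq_re_cgrad] at h
  refine ⟨_, ?_, rfl⟩
  convert h using 1
  · simp [Complex.normSq_apply]; ring
  · simp [Complex.normSq_apply]; ring

theorem energy_term_laplacian (κ X a b : ℂ) :
    (4 * (κ * X).re ^ 2 * Complex.normSq a + 8 * (κ * X).re * (starRingEnd ℂ a * b).re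
      + 2 * Complex.normSq b)
    + (4 * (κ * (Complex.I * X)).re ^ 2 * Complex.normSq a
      + 8 * (κ * (Complex.I * X)).re * (starRingEnd ℂ a * (Complex.I * b)).re
      + 2 * Complex.normSq (Complex.I * b)) = 4 * Complex.normSq (κ * X * a + b) := by
  simp [Complex.normSq_apply]; ring

/-- The polygon through the points `x 0, x 1, …`, parametrised by `[0, ∞)`. -/
noncomputable def polygon (x : ℕ → ℂ) (s : ℝ) : ℂ :=
  x ⌊s⌋₊ + (s - ⌊s⌋₊) • (x (⌊s⌋₊ + 1) - x ⌊s⌋₊)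

theorem polygon_eq (x : ℕ → ℂ) (k : ℕ) {s : ℝ} (h1 : k ≤ s) (h2 : s ≤ k + 1) :
    polygon x s = x k + (s - k) • (x (k + 1) - x k) := by
  rcases h2.lt_or_eq with h | h
  · have : ⌊s⌋₊ = k := (Nat.floor_eq_iff (by linarith [Nat.cast_nonneg (α := ℝ) k])).2 ⟨h1, h⟩
    rw [polygon, this]
  · have : ⌊s⌋₊ = k + 1 := by
      rw [h]; exact_mod_cast Nat.floor_natCast (R := ℝ) (k + 1)
    rw [polygon, this, h]; simp

theorem polygon_mem_segment (x : ℕ → ℂ) (k : ℕ) {s : ℝ} (h1 : k ≤ s) (h2 : s ≤ k + 1) :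
    polygon x s ∈ segment ℝ (x k) (x (k + 1)) := by
  rw [polygon_eq x k h1 h2, segment_eq_image']
  exact ⟨s - k, ⟨by linarith, by linarith⟩, rfl⟩

theorem continuousOn_polygon (x : ℕ → ℂ) : ContinuousOn (polygon x) (Set.Ici 0) := by
  have key : ∀ n : ℕ, ContinuousOn (polygon x) (Set.Icc 0 (n : ℝ)) := by
    intro n
    induction n with
    | zero => simp
    | succ n ih =>
      have h1 : ContinuousOn (polygon x) (Set.Icc (n : ℝ) (n + 1)) := by
        have : ContinuousOn (fun s : ℝ => x n + (s - n) • (x (n + 1) - x n))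
            (Set.Icc (n : ℝ) (n + 1)) := by fun_prop
        exact this.congr fun s hs => polygon_eq x n hs.1 hs.2
      have h2 := ih.union_of_isClosed h1 isClosed_Icc isClosed_Icc
      rw [Set.Icc_union_Icc_eq_Icc (Nat.cast_nonneg n) (by linarith)] at h2
      exact_mod_cast h2
  intro s hs
  obtain ⟨n, hn⟩ := exists_nat_gt s
  have h1 : ContinuousWithinAt (polygon x) (Set.Icc 0 (n : ℝ)) s := key n s ⟨hs, hn.le⟩
  refine h1.mono_of_mem_nhdsWithin ?_
  rw [← Set.Ici_inter_Iic]
  exact Filter.inter_mem self_mem_nhdsWithin (mem_nhdsWithin_of_mem_nhds (Iic_mem_nhds hn))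

theorem div_one_sub_mem_iff {t k : ℝ} (ht : t < 1) (hk : 0 ≤ k) :
    (k ≤ t / (1 - t) ↔ k / (k + 1) ≤ t) ∧ (t / (1 - t) ≤ k ↔ t ≤ k / (k + 1)) := by
  have h1 : 0 < 1 - t := by linarith
  have h2 : 0 < k + 1 := by linarith
  rw [le_div_iff₀ h1, div_le_iff₀ h2, div_le_iff₀ h1, le_div_iff₀ h2]
  constructor <;> constructor <;> intro h <;> nlinarith

/-- A divergent polygon of finite length contradicts completeness. -/
theorem not_conformallyComplete_of_polygon {v : ℂ → ℝ} {Ω : Set ℂ} (x : ℕ → ℂ) (c : ℕ → ℝ)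
    (hΩ : ∀ k, segment ℝ (x k) (x (k + 1)) ⊆ Ω)
    (hc : ∀ k, ∀ z ∈ segment ℝ (x k) (x (k + 1)), Real.exp (v z) * ‖x (k + 1) - x k‖ ≤ c k)
    (hsum : Summable c)
    (hK : ∀ K : Set ℂ, IsCompact K → K ⊆ Ω →
      ∀ᶠ k in atTop, ∀ z ∈ segment ℝ (x k) (x (k + 1)), z ∉ K) :
    ¬ ConformallyComplete v Ω := by
  intro hcomp
  have hc0 : ∀ k, 0 ≤ c k := fun k =>
    le_trans (by positivity) (hc k (x k) (left_mem_segment ℝ _ _))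
  set σ : ℝ → ℝ := fun t => t / (1 - t) with hσ
  set γ : ℝ → ℂ := fun t => polygon x (σ t) with hγ
  have hσ0 : ∀ t ∈ Set.Ico (0 : ℝ) 1, 0 ≤ σ t := fun t ht =>
    div_nonneg ht.1 (by linarith [ht.2])
  have hfl : ∀ t ∈ Set.Ico (0 : ℝ) 1, (⌊σ t⌋₊ : ℝ) ≤ σ t ∧ σ t ≤ (⌊σ t⌋₊ : ℝ) + 1 := fun t ht =>
    ⟨Nat.floor_le (hσ0 t ht), (Nat.lt_floor_add_one _).le⟩
  have hseg : ∀ t ∈ Set.Ico (0 : ℝ) 1, γ t ∈ segment ℝ (x ⌊σ t⌋₊) (x (⌊σ t⌋₊ + 1)) := fun t ht =>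
    polygon_mem_segment x _ (hfl t ht).1 (hfl t ht).2
  have hpiece : ∀ (k : ℕ) (t : ℝ), (k : ℝ) / (k + 1) ≤ t → t ≤ ((k + 1 : ℕ) : ℝ) / ((k + 1 : ℕ) + 1) →
      t < 1 ∧ (k : ℝ) ≤ σ t ∧ σ t ≤ k + 1 := by
    intro k t h1 h2
    have ht : t < 1 := lt_of_le_of_lt h2 (by rw [div_lt_one (by positivity)]; linarith)
    refine ⟨ht, (div_one_sub_mem_iff ht (Nat.cast_nonneg k)).1.2 h1, ?_⟩
    have := (div_one_sub_mem_iff ht (Nat.cast_nonneg (k + 1))).2.2 h2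
    push_cast at this
    exact this
  have hγeq : ∀ (k : ℕ) (t : ℝ), (k : ℝ) / (k + 1) ≤ t →
      t ≤ ((k + 1 : ℕ) : ℝ) / ((k + 1 : ℕ) + 1) →
      γ t = x k + (σ t - k) • (x (k + 1) - x k) := fun k t h1 h2 =>
    polygon_eq x k (hpiece k t h1 h2).2.1 (hpiece k t h1 h2).2.2
  have hlen := hcomp γ ?_ (fun t ht => hΩ _ (hseg t ht)) ?_ ?_
  · have hcover : Set.Ioo (0 : ℝ) 1 ⊆
        ⋃ k : ℕ, Set.Icc ((k : ℝ) / (k + 1)) (((k + 1 : ℕ) : ℝ) / ((k + 1 : ℕ) + 1)) := by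
      intro t ht
      refine Set.mem_iUnion.2 ⟨⌊σ t⌋₊, ?_, ?_⟩
      · exact (div_one_sub_mem_iff ht.2 (Nat.cast_nonneg _)).1.1 (hfl t ⟨ht.1.le, ht.2⟩).1
      · refine (div_one_sub_mem_iff ht.2 (Nat.cast_nonneg _)).2.1 ?_
        push_cast
        exact (hfl t ⟨ht.1.le, ht.2⟩).2
    have hbound : ∀ k : ℕ, ∫⁻ t in Set.Icc ((k : ℝ) / (k + 1)) (((k + 1 : ℕ) : ℝ) / ((k + 1 : ℕ) + 1)),
        ENNReal.ofReal (Real.exp (v (γ t)) * ‖deriv γ t‖) ≤ ENNReal.ofReal (2 * c k) := by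
      intro k
      rw [← MeasureTheory.setLIntegral_congr MeasureTheory.Ioo_ae_eq_Icc]
      have hpt : ∀ t ∈ Set.Ioo ((k : ℝ) / (k + 1)) (((k + 1 : ℕ) : ℝ) / ((k + 1 : ℕ) + 1)),
          ENNReal.ofReal (Real.exp (v (γ t)) * ‖deriv γ t‖) ≤ ENNReal.ofReal ((k + 2) ^ 2 * c k) := by
        intro t ht
        obtain ⟨ht1, hk1, hk2⟩ := hpiece k t ht.1.le ht.2.le
        have h1t : 0 < 1 - t := by linarith
        have hd : HasDerivAt σ (1 / (1 - t) ^ 2) t := by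
          refine ((hasDerivAt_id t).div ((hasDerivAt_id t).const_sub 1) h1t.ne').congr_deriv ?_
          simp
        have hd2 : HasDerivAt γ ((1 / (1 - t) ^ 2) • (x (k + 1) - x k)) t := by
          have h3 := ((hd.sub_const (k : ℝ)).smul_const (x (k + 1) - x k)).const_add (x k)
          refine h3.congr_of_eventuallyEq ?_
          filter_upwards [isOpen_Ioo.mem_nhds ht] with y hy using hγeq k y hy.1.le hy.2.le
        rw [hd2.deriv, norm_smul, Real.norm_of_nonneg (by positivity)]
        apply ENNReal.ofReal_le_ofReal
        have h4 : 1 / (1 - t) ≤ k + 2 := by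
          have : 1 / (1 - t) = 1 + σ t := by rw [hσ]; field_simp; ring
          rw [this]; linarith
        have h5 : 1 / (1 - t) ^ 2 ≤ ((k : ℝ) + 2) ^ 2 := by
          rw [← one_div_pow]; gcongr
        have h6 := hc k (γ t) (polygon_mem_segment x k hk1 hk2)
        calc _ = 1 / (1 - t) ^ 2 * (Real.exp (v (γ t)) * ‖x (k + 1) - x k‖) := by ring
          _ ≤ _ := by gcongr
      refine (MeasureTheory.setLIntegral_mono measurable_const hpt).trans ?_
      rw [MeasureTheory.setLIntegral_const, Real.volume_Ioo,
        ← ENNReal.ofReal_mul (by have := hc0 k; positivity)]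
      apply ENNReal.ofReal_le_ofReal
      have h7 : ((k : ℝ) + 2) ^ 2 * (((k + 1 : ℕ) : ℝ) / ((k + 1 : ℕ) + 1) - (k : ℝ) / (k + 1)) ≤ 2 := by
        have : ((k : ℝ) + 2) ^ 2 * (((k + 1 : ℕ) : ℝ) / ((k + 1 : ℕ) + 1) - (k : ℝ) / (k + 1))
            = (k + 2) / (k + 1) := by
          push_cast
          field_simp
          ring
        rw [this, div_le_iff₀ (by positivity)]
        linarith [Nat.cast_nonneg (α := ℝ) k]
      calc _ = ((k : ℝ) + 2) ^ 2 * (((k + 1 : ℕ) : ℝ) / ((k + 1 : ℕ) + 1) - (k : ℝ) / (k + 1)) * c k := by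
            ring
        _ ≤ _ := by gcongr; exact hc0 k
    have hle : (⊤ : ENNReal) ≤ ∑' k, ENNReal.ofReal (2 * c k) := by
      rw [← hlen]
      exact (MeasureTheory.lintegral_mono_set hcover).trans
        ((MeasureTheory.lintegral_iUnion_le _ _).trans (ENNReal.tsum_le_tsum hbound))
    have hs2 : Summable fun k => 2 * c k := hsum.mul_left 2
    rw [← ENNReal.ofReal_tsum_of_nonneg (fun k => mul_nonneg two_pos.le (hc0 k)) hs2] at hle
    exact ENNReal.ofReal_ne_top (top_le_iff.1 hle)
  · have h1 : ContinuousOn σ (Set.Ico 0 1) :=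
      continuousOn_id.div (continuousOn_const.sub continuousOn_id)
        fun t ht => (sub_pos.2 ht.2).ne'
    exact (continuousOn_polygon x).comp h1 hσ0
  · intro s hs
    set k := ⌊σ s⌋₊ with hk
    have hks : (k : ℝ) / (k + 1) ≤ s := (div_one_sub_mem_iff hs.2 (Nat.cast_nonneg _)).1.1 (hfl s hs).1
    have hsk : s ≤ ((k + 1 : ℕ) : ℝ) / ((k + 1 : ℕ) + 1) := by
      refine (div_one_sub_mem_iff hs.2 (Nat.cast_nonneg _)).2.1 ?_
      push_cast
      exact (hfl s hs).2
    have hmono : ∀ i j : ℕ, i ≤ j → (i : ℝ) / (i + 1) ≤ (j : ℝ) / (j + 1) := by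
      intro i j hij
      have : (i : ℝ) ≤ j := by exact_mod_cast hij
      rw [div_le_div_iff₀ (by positivity) (by positivity)]
      linarith
    refine ⟨k + 1, fun i => min (((i : ℕ) : ℝ) / ((i : ℕ) + 1)) s, ?_, ?_, ?_, ?_⟩
    · intro i j hij
      exact min_le_min_right s (hmono i j hij)
    · simpa using hs.1
    · simpa using hsk
    · intro i
      have hi : (i : ℕ) ≤ k := Nat.lt_succ_iff.1 i.2
      have hcd : ContDiffOn ℝ 1 (fun t : ℝ => x i + (t / (1 - t) - (i : ℕ)) • (x (i + 1) - x i))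
          (Set.Iio 1) := by
        have hdiv : ContDiffOn ℝ 1 (fun t : ℝ => t / (1 - t)) (Set.Iio 1) :=
          contDiffOn_id.div (contDiffOn_const.sub contDiffOn_id) fun t ht => (sub_pos.2 ht).ne'
        fun_prop
      have hp : ∀ t ∈ Set.Icc (min (((i.castSucc : ℕ) : ℝ) / ((i.castSucc : ℕ) + 1)) s)
          (min (((i.succ : ℕ) : ℝ) / ((i.succ : ℕ) + 1)) s),
          ((i : ℕ) : ℝ) / ((i : ℕ) + 1) ≤ t ∧ t ≤ (((i : ℕ) + 1 : ℕ) : ℝ) / (((i : ℕ) + 1 : ℕ) + 1) := by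
        intro t ht
        have h1 := ht.1
        rw [Fin.val_castSucc, min_eq_left ((hmono i k hi).trans hks)] at h1
        exact ⟨h1, by simpa using ht.2.trans (min_le_left _ _)⟩
      refine (hcd.mono fun t ht => (hpiece i t (hp t ht).1 (hp t ht).2).1).congr fun t ht => ?_
      exact hγeq i t (hp t ht).1 (hp t ht).2
  · intro K hKc hKΩ
    obtain ⟨n, hn⟩ := eventually_atTop.1 (hK K hKc hKΩ)
    have hn1 : (n : ℝ) / (n + 1) < 1 := by rw [div_lt_one (by positivity)]; linarith
    refine ⟨(n : ℝ) / (n + 1), by positivity, hn1, fun t ht1 ht2 => ?_⟩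
    have ht : t ∈ Set.Ico (0 : ℝ) 1 := ⟨le_trans (by positivity) ht1, ht2⟩
    have h1 : (n : ℝ) ≤ σ t := (div_one_sub_mem_iff ht2 (Nat.cast_nonneg n)).1.2 ht1
    exact hn _ (Nat.le_floor h1) _ (hseg t ht)

theorem IsCompact.exists_uniform_radius {K : Set ℂ} (hK : IsCompact K) {r : ℂ → ℂ → Prop}
    (h : ∀ x ∈ K, ∀ᶠ q : ℂ × ℂ in 𝓝 (x, x), r q.1 q.2) :
    ∃ η > 0, ∀ z ∈ K, ∀ z', dist z' z < η → r z z' := by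
  refine hK.induction_on (p := fun S => ∃ η > 0, ∀ z ∈ S, ∀ z', dist z' z < η → r z z')
    ⟨1, one_pos, by simp⟩ ?_ ?_ ?_
  · rintro S T hST ⟨η, h0, h1⟩
    exact ⟨η, h0, fun z hz => h1 z (hST hz)⟩
  · rintro S T ⟨η, h0, h1⟩ ⟨η', h0', h1'⟩
    refine ⟨min η η', lt_min h0 h0', ?_⟩
    rintro z (hz | hz) z' hd
    · exact h1 z hz z' (hd.trans_le (min_le_left _ _))
    · exact h1' z hz z' (hd.trans_le (min_le_right _ _))
  · intro x hx
    obtain ⟨ε, h0, h1⟩ := Metric.eventually_nhds_iff.1 (h x hx)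
    refine ⟨Metric.ball x (ε / 2), mem_nhdsWithin_of_mem_nhds (Metric.ball_mem_nhds x (by linarith)),
      ε / 2, by linarith, fun z hz z' hd => h1 (y := (z, z')) ?_⟩
    have hz' : dist z x < ε / 2 := hz
    rw [Prod.dist_eq]
    refine max_lt (by simp only; linarith) ?_
    have := dist_triangle z' z x
    simp only
    linarith

/-- The closed ball of radius `s ≤ 1` about `x` lies in `Ω`, and `e^v` varies by a factor of at
most `2` there. -/
structure IsGoodRadius (v : ℂ → ℝ) (Ω : Set ℂ) (x : ℂ) (s : ℝ) : Prop where
  pos : 0 < s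
  le_one : s ≤ 1
  subset : Metric.closedBall x s ⊆ Ω
  osc : ∀ a ∈ Metric.closedBall x s, ∀ b ∈ Metric.closedBall x s, Real.exp (v a) ≤ 2 * Real.exp (v b)

theorem IsGoodRadius.mono {v : ℂ → ℝ} {Ω : Set ℂ} {x y : ℂ} {s t : ℝ} (h : IsGoodRadius v Ω x s)
    (ht : 0 < t) (hts : t + dist y x ≤ s) : IsGoodRadius v Ω y t := by
  have hsub : Metric.closedBall y t ⊆ Metric.closedBall x s :=
    Metric.closedBall_subset_closedBall' hts
  exact ⟨ht, by linarith [h.le_one, dist_nonneg (x := y) (y := x)], hsub.trans h.subset,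
    fun a ha b hb => h.osc a (hsub ha) b (hsub hb)⟩

theorem exists_isGoodRadius {v : ℂ → ℝ} {Ω : Set ℂ} (hopen : IsOpen Ω) (hv : ContinuousOn v Ω)
    {x : ℂ} (hx : x ∈ Ω) : ∃ s, IsGoodRadius v Ω x s := by
  have hc : ContinuousAt (fun z => Real.exp (v z)) x :=
    (hv.continuousAt (hopen.mem_nhds hx)).rexp
  have hpos := Real.exp_pos (v x)
  have h1 : ∀ᶠ z in 𝓝 x, Real.exp (v z) < 6 / 5 * Real.exp (v x) :=
    hc.eventually (gt_mem_nhds (by linarith))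
  have h2 : ∀ᶠ z in 𝓝 x, 4 / 5 * Real.exp (v x) < Real.exp (v z) :=
    hc.eventually (lt_mem_nhds (by linarith))
  obtain ⟨ε, h0, hε⟩ := Metric.nhds_basis_closedBall.eventually_iff.1
    ((h1.and h2).and (hopen.mem_nhds hx))
  have hsub : Metric.closedBall x (min ε 1) ⊆ Metric.closedBall x ε :=
    Metric.closedBall_subset_closedBall (min_le_left _ _)
  refine ⟨min ε 1, lt_min h0 one_pos, min_le_right _ _, fun z hz => (hε (hsub hz)).2, ?_⟩
  intro a ha b hb
  have := (hε (hsub ha)).1.1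
  have := (hε (hsub hb)).1.2
  linarith

theorem IsCompact.exists_isGoodRadius {v : ℂ → ℝ} {Ω K : Set ℂ} (hopen : IsOpen Ω)
    (hv : ContinuousOn v Ω) (hK : IsCompact K) (hKΩ : K ⊆ Ω) :
    ∃ s > 0, ∀ z ∈ K, IsGoodRadius v Ω z s := by
  refine hK.induction_on (p := fun S => ∃ s > 0, ∀ z ∈ S, IsGoodRadius v Ω z s)
    ⟨1, one_pos, by simp⟩ ?_ ?_ ?_
  · rintro S T hST ⟨η, h0, h1⟩
    exact ⟨η, h0, fun z hz => h1 z (hST hz)⟩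
  · rintro S T ⟨η, h0, h1⟩ ⟨η', h0', h1'⟩
    refine ⟨min η η', lt_min h0 h0', ?_⟩
    rintro z (hz | hz)
    · exact (h1 z hz).mono (lt_min h0 h0') (by simp)
    · exact (h1' z hz).mono (lt_min h0 h0') (by simp)
  · intro x hx
    obtain ⟨s, hs⟩ := _root_.exists_isGoodRadius hopen hv (hKΩ hx)
    have h0 := hs.pos
    refine ⟨Metric.ball x (s / 2), mem_nhdsWithin_of_mem_nhds (Metric.ball_mem_nhds x (by linarith)),
      s / 2, by linarith, fun z hz => hs.mono (by linarith) ?_⟩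
    have : dist z x < s / 2 := hz
    linarith

theorem exists_isGoodRadius_half_max {v : ℂ → ℝ} {Ω : Set ℂ} (hopen : IsOpen Ω)
    (hv : ContinuousOn v Ω) {x : ℂ} (hx : x ∈ Ω) :
    ∃ s, IsGoodRadius v Ω x s ∧ ∀ s', IsGoodRadius v Ω x s' → s' ≤ 2 * s := by
  obtain ⟨s₀, hs₀⟩ := exists_isGoodRadius hopen hv hx
  have hb : BddAbove {s | IsGoodRadius v Ω x s} := ⟨1, fun s hs => hs.le_one⟩
  have hpos : 0 < sSup {s | IsGoodRadius v Ω x s} := hs₀.pos.trans_le (le_csSup hb hs₀)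
  obtain ⟨s, hs, hlt⟩ := exists_lt_of_lt_csSup ⟨s₀, hs₀⟩ (half_lt_self hpos)
  refine ⟨s, hs, fun s' hs' => ?_⟩
  have h1 : s' ≤ sSup {s | IsGoodRadius v Ω x s} := le_csSup hb hs'
  have h2 : sSup {s | IsGoodRadius v Ω x s} / 2 < s := hlt
  linarith

/-- Compactly supported functions which are locally Lipschitz with constant at most `1` for the
metric `e^{2v}|dz|²`. -/
structure IsShortBump (v : ℂ → ℝ) (Ω : Set ℂ) (f : ℂ → ℝ) : Prop where
  supp : ∃ K, IsCompact K ∧ K ⊆ Ω ∧ ∀ z ∉ K, f z = 0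
  lip : ∀ x ∈ Ω, ∀ᶠ q : ℂ × ℂ in 𝓝 (x, x), |f q.1 - f q.2| ≤ Real.exp (v x) * dist q.1 q.2

namespace IsShortBump

variable {v : ℂ → ℝ} {Ω : Set ℂ} {f g : ℂ → ℝ}

theorem zero : IsShortBump v Ω fun _ => 0 :=
  ⟨⟨∅, isCompact_empty, by simp, by simp⟩, fun x _ => Eventually.of_forall fun q => by
    simp only [sub_self, abs_zero]; positivity⟩

theorem continuousAt (hf : IsShortBump v Ω f) {x : ℂ} (hx : x ∈ Ω) : ContinuousAt f x := by
  have h1 : Tendsto (fun y : ℂ => (y, x)) (𝓝 x) (𝓝 (x, x)) :=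
    (continuous_id.prodMk continuous_const).tendsto x
  have h2 := h1.eventually (hf.lip x hx)
  rw [ContinuousAt, tendsto_iff_dist_tendsto_zero]
  refine squeeze_zero' (g := fun y => Real.exp (v x) * dist y x)
    (Eventually.of_forall fun _ => dist_nonneg) h2 ?_
  have : Continuous fun y => Real.exp (v x) * dist y x := by fun_prop
  simpa using this.tendsto x

theorem max (hf : IsShortBump v Ω f) (hg : IsShortBump v Ω g) :
    IsShortBump v Ω fun z => Max.max (f z) (g z) := by
  obtain ⟨K, h1, h2, h3⟩ := hf.supp
  obtain ⟨L, k1, k2, k3⟩ := hg.supp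
  refine ⟨⟨K ∪ L, h1.union k1, Set.union_subset h2 k2, fun z hz => ?_⟩, fun x hx => ?_⟩
  · rw [Set.mem_union, not_or] at hz
    simp [h3 z hz.1, k3 z hz.2]
  · filter_upwards [hf.lip x hx, hg.lip x hx] with q h1 h2
    exact (abs_max_sub_max_le_max _ _ _ _).trans (max_le h1 h2)

/-- Raising a bump inside a disc, up to a cone that lies below it on the boundary circle. -/
theorem raise (hf : IsShortBump v Ω f) {x : ℂ} {s l : ℝ}
    (hs : IsGoodRadius v Ω x s) (hl : ∀ y ∈ Metric.sphere x s, l < f y) :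
    ∃ g, IsShortBump v Ω g ∧ l + Real.exp (v x) / 2 * s ≤ g x := by
  classical
  set m := Real.exp (v x) / 2 with hm
  set cone : ℂ → ℝ := fun z => l + m * (s - dist z x) with hcone
  have hm0 : 0 ≤ m := by positivity
  have hxD : x ∈ Metric.closedBall x s := Metric.mem_closedBall_self hs.pos.le
  set g : ℂ → ℝ := fun z => if z ∈ Metric.closedBall x s then Max.max (f z) (cone z) else f z with hg
  have hcl : ∀ a b, |cone a - cone b| ≤ m * dist a b := by
    intro a b
    have : cone a - cone b = m * (dist b x - dist a x) := by simp only [hcone]; ring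
    rw [this, abs_mul, abs_of_nonneg hm0, dist_comm a b]
    gcongr
    exact abs_dist_sub_le b a x
  refine ⟨g, ⟨?_, ?_⟩, ?_⟩
  · obtain ⟨K, h1, h2, h3⟩ := hf.supp
    refine ⟨K ∪ Metric.closedBall x s, h1.union (isCompact_closedBall x s),
      Set.union_subset h2 hs.subset, fun z hz => ?_⟩
    rw [Set.mem_union, not_or] at hz
    simp only [hg, if_neg hz.2, h3 z hz.1]
  · intro y hy
    rcases lt_trichotomy (dist y x) s with h | h | h
    · have hball : Metric.ball x s ∈ 𝓝 y := Metric.isOpen_ball.mem_nhds h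
      have hmy : m ≤ Real.exp (v y) := by
        have := hs.osc x hxD y (Metric.ball_subset_closedBall h)
        rw [hm]; linarith
      filter_upwards [hf.lip y hy, prod_mem_nhds hball hball] with q h1 h2
      have e : ∀ z ∈ Metric.ball x s, g z = Max.max (f z) (cone z) := fun z hz =>
        if_pos (Metric.ball_subset_closedBall hz)
      rw [e _ h2.1, e _ h2.2]
      refine (abs_max_sub_max_le_max _ _ _ _).trans (max_le h1 ((hcl _ _).trans ?_))
      gcongr
    · have hc : ContinuousAt (fun z => f z - cone z) y :=
        (hf.continuousAt hy).sub (by simp only [hcone]; fun_prop)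
      have h1 : ∀ᶠ z in 𝓝 y, 0 < f z - cone z := by
        refine hc.eventually (lt_mem_nhds ?_)
        have := hl y h
        simp only [hcone, h]; linarith
      have h2 : ∀ᶠ z in 𝓝 y, g z = f z := by
        filter_upwards [h1] with z hz
        simp only [hg]
        split_ifs
        · exact max_eq_left (by linarith)
        · rfl
      filter_upwards [hf.lip y hy, prod_mem_nhds h2 h2] with q h3 h4
      rw [show g q.1 = f q.1 from h4.1, show g q.2 = f q.2 from h4.2]
      exact h3
    · have h2 : ∀ᶠ z in 𝓝 y, g z = f z := by
        have : (Metric.closedBall x s)ᶜ ∈ 𝓝 y :=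
          Metric.isClosed_closedBall.isOpen_compl.mem_nhds (by simpa using h)
        filter_upwards [this] with z hz
        exact if_neg hz
      filter_upwards [hf.lip y hy, prod_mem_nhds h2 h2] with q h3 h4
      rw [show g q.1 = f q.1 from h4.1, show g q.2 = f q.2 from h4.2]
      exact h3
  · have : g x = Max.max (f x) (cone x) := if_pos hxD
    rw [this]
    refine le_trans ?_ (le_max_right _ _)
    simp [hcone]

/-- If all bumps are bounded by `r` at `x`, the bound improves at some point of a circle. -/
theorem exists_descent {x : ℂ} {s r : ℝ} (hs : IsGoodRadius v Ω x s)
    (hr : ∀ f, IsShortBump v Ω f → f x ≤ r) :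
    ∃ y ∈ Metric.sphere x s, ∀ f, IsShortBump v Ω f → f y ≤ r - Real.exp (v x) * s / 4 := by
  by_contra! hcon
  have hex : ∃ f, IsShortBump v Ω f ∧
      ∀ y ∈ Metric.sphere x s, r - Real.exp (v x) * s / 4 < f y := by
    refine (isCompact_sphere x s).induction_on (p := fun S => ∃ f, IsShortBump v Ω f ∧
      ∀ y ∈ S, r - Real.exp (v x) * s / 4 < f y) ⟨_, zero, by simp⟩ ?_ ?_ ?_
    · rintro S T hST ⟨f, h1, h2⟩
      exact ⟨f, h1, fun y hy => h2 y (hST hy)⟩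
    · rintro S T ⟨f, h1, h2⟩ ⟨g, k1, k2⟩
      refine ⟨_, h1.max k1, ?_⟩
      rintro y (hy | hy)
      · exact lt_max_of_lt_left (h2 y hy)
      · exact lt_max_of_lt_right (k2 y hy)
    · intro y hy
      obtain ⟨f, h1, h2⟩ := hcon y hy
      have hyΩ : y ∈ Ω := hs.subset (Metric.sphere_subset_closedBall hy)
      exact ⟨_, mem_nhdsWithin_of_mem_nhds ((h1.continuousAt hyΩ).eventually (lt_mem_nhds h2)),
        f, h1, fun z hz => hz⟩
  obtain ⟨f, h1, h2⟩ := hex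
  obtain ⟨g, h3, h4⟩ := h1.raise hs h2
  have h5 := hr g h3
  have : 0 < Real.exp (v x) * s := mul_pos (Real.exp_pos _) hs.pos
  linarith

end IsShortBump

/-- Hopf–Rinow in dual form: a complete metric has arbitrarily high short bumps. -/
theorem ConformallyComplete.exists_isShortBump {v : ℂ → ℝ} {Ω : Set ℂ} (hopen : IsOpen Ω)
    (hv : ContinuousOn v Ω) (hcomp : ConformallyComplete v Ω) {p : ℂ} (hp : p ∈ Ω) (R : ℝ) :
    ∃ f, IsShortBump v Ω f ∧ R < f p := by
  by_contra! hcon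
  choose! s hs hsmax using fun x (hx : x ∈ Ω) => exists_isGoodRadius_half_max hopen hv hx
  have hstep : ∀ q : {q : ℂ × ℝ // q.1 ∈ Ω ∧ ∀ f, IsShortBump v Ω f → f q.1 ≤ q.2},
      ∃ q' : {q : ℂ × ℝ // q.1 ∈ Ω ∧ ∀ f, IsShortBump v Ω f → f q.1 ≤ q.2},
        dist q'.1.1 q.1.1 = s q.1.1 ∧ q'.1.2 = q.1.2 - Real.exp (v q.1.1) * s q.1.1 / 4 := by
    rintro ⟨⟨x, r⟩, hx, hr⟩
    obtain ⟨y, hy, hyr⟩ := IsShortBump.exists_descent (hs x hx) hr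
    exact ⟨⟨(y, _), (hs x hx).subset (Metric.sphere_subset_closedBall hy), hyr⟩, hy, rfl⟩
  choose next hn1 hn2 using hstep
  set Q : ℕ → {q : ℂ × ℝ // q.1 ∈ Ω ∧ ∀ f, IsShortBump v Ω f → f q.1 ≤ q.2} :=
    fun n => Nat.rec ⟨(p, R), hp, hcon⟩ (fun _ q => next q) n with hQ
  set x : ℕ → ℂ := fun n => (Q n).1.1 with hx
  have hxΩ : ∀ n, x n ∈ Ω := fun n => (Q n).2.1
  have hd : ∀ n, dist (x (n + 1)) (x n) = s (x n) := fun n => hn1 (Q n)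
  have hr : ∀ n, (Q (n + 1)).1.2 = (Q n).1.2 - Real.exp (v (x n)) * s (x n) / 4 := fun n => hn2 (Q n)
  have hr0 : ∀ n, 0 ≤ (Q n).1.2 := fun n => (Q n).2.2 _ IsShortBump.zero
  have hpart : ∀ n, ∑ k ∈ Finset.range n, Real.exp (v (x k)) * s (x k) = 4 * (R - (Q n).1.2) := by
    intro n
    induction n with
    | zero => simp [hQ]
    | succ n ih => rw [Finset.sum_range_succ, ih, hr n]; ring
  have hterm0 : ∀ n, 0 ≤ Real.exp (v (x n)) * s (x n) := fun n =>
    mul_nonneg (Real.exp_pos _).le (hs _ (hxΩ n)).pos.le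
  have hsum : Summable fun n => Real.exp (v (x n)) * s (x n) :=
    summable_of_sum_range_le (c := 4 * R) hterm0 fun n => by
      rw [hpart]; linarith [hr0 n]
  have hsegball : ∀ n, segment ℝ (x n) (x (n + 1)) ⊆ Metric.closedBall (x n) (s (x n)) := fun n =>
    (convex_closedBall _ _).segment_subset (Metric.mem_closedBall_self (hs _ (hxΩ n)).pos.le)
      (Metric.mem_closedBall.2 (hd n).le)
  refine not_conformallyComplete_of_polygon x (fun n => 2 * (Real.exp (v (x n)) * s (x n)))
    (fun n => (hsegball n).trans (hs _ (hxΩ n)).subset) ?_ (hsum.mul_left 2) ?_ hcomp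
  · intro n z hz
    have h1 := hs _ (hxΩ n)
    have h2 := h1.osc z (hsegball n hz) (x n) (Metric.mem_closedBall_self h1.pos.le)
    rw [← dist_eq_norm, hd n, ← mul_assoc]
    exact mul_le_mul_of_nonneg_right h2 h1.pos.le
  · intro K hK hKΩ
    obtain ⟨c, hc0, hc⟩ := hK.exists_isGoodRadius hopen hv hKΩ
    obtain ⟨e, he0, he⟩ : ∃ e > 0, ∀ z ∈ K, e ≤ Real.exp (v z) := by
      rcases K.eq_empty_or_nonempty with rfl | hne
      · exact ⟨1, one_pos, by simp⟩
      · obtain ⟨z, hz, hmin⟩ := hK.exists_isMinOn hne ((hv.mono hKΩ).rexp)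
        exact ⟨_, Real.exp_pos (v z), fun w hw => hmin hw⟩
    have hev : ∀ᶠ n in atTop, Real.exp (v (x n)) * s (x n) < e / 2 * (c / 4) :=
      hsum.tendsto_atTop_zero.eventually (gt_mem_nhds (by positivity))
    filter_upwards [hev] with n hlt z hz hzK
    have h1 := hs _ (hxΩ n)
    have h2 := h1.osc z (hsegball n hz) (x n) (Metric.mem_closedBall_self h1.pos.le)
    have h3 : e / 2 ≤ Real.exp (v (x n)) := by linarith [he z hzK]
    have h4 : c / 4 ≤ s (x n) := by
      by_contra! hlt'
      have h5 : dist (x n) z ≤ s (x n) := by rw [dist_comm]; exact hsegball n hz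
      have h6 := hsmax _ (hxΩ n) (c / 2) ((hc z hzK).mono (by linarith) (by linarith))
      linarith
    have := mul_le_mul h3 h4 (by positivity) (Real.exp_pos _).le
    linarith

theorem abs_log_norm_one_sub_add_re_le {ξ : ℂ} (h : ‖ξ‖ ≤ 1 / 2) :
    |Real.log ‖1 - ξ‖ + ξ.re| ≤ ‖ξ‖ ^ 2 := by
  have h1 := Complex.norm_log_one_add_sub_self_le (z := -ξ) (by rw [norm_neg]; linarith)
  have h2 : (Complex.log (1 + -ξ) - -ξ).re = Real.log ‖1 - ξ‖ + ξ.re := by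
    simp [Complex.log_re, sub_eq_add_neg]
  rw [← h2]
  refine (Complex.abs_re_le_norm _).trans (h1.trans ?_)
  rw [norm_neg]
  have h3 : (1 - ‖ξ‖)⁻¹ ≤ 2 := by
    rw [inv_le_comm₀ (by linarith) two_pos]; linarith
  nlinarith [sq_nonneg ‖ξ‖]

/-- Discrete parallel transport distorts lengths only to first order in the step. -/
theorem eventually_transport_estimate {v : ℂ → ℝ} {Ω : Set ℂ} (hopen : IsOpen Ω)
    (hv : ContDiffOn ℝ 2 v Ω) {x : ℂ} (hx : x ∈ Ω) {ε : ℝ} (hε : 0 < ε) :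
    ∀ᶠ q : ℂ × ℂ in 𝓝 (x, x), 1 - cgrad v q.1 * (q.2 - q.1) ≠ 0 ∧
      |Real.log ‖1 - cgrad v q.1 * (q.2 - q.1)‖ + v q.2 - v q.1| ≤ ε * ‖q.2 - q.1‖ := by
  have hstrict : HasStrictFDerivAt v (fderiv ℝ v x) x :=
    (hv.contDiffAt (hopen.mem_nhds hx)).hasStrictFDerivAt (by norm_num)
  have h1 := hstrict.isLittleO.def (c := ε / 4) (by linarith)
  have hκ : ContinuousAt (cgrad v) x := (continuousOn_cgrad hopen hv).continuousAt (hopen.mem_nhds hx)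
  have hκ1 : ContinuousAt (fun q : ℂ × ℂ => cgrad v q.1) (x, x) :=
    ContinuousAt.comp (f := Prod.fst) (x := (x, x)) hκ continuousAt_fst
  have hξ : ContinuousAt (fun q : ℂ × ℂ => cgrad v q.1 * (q.2 - q.1)) (x, x) :=
    hκ1.mul (continuousAt_snd.sub continuousAt_fst)
  have h2 : ∀ᶠ q : ℂ × ℂ in 𝓝 (x, x), ‖cgrad v q.1 - cgrad v x‖ < ε / 4 :=
    (hκ1.sub continuousAt_const).norm.eventually (gt_mem_nhds (by simpa using by linarith))
  have h3 : ∀ᶠ q : ℂ × ℂ in 𝓝 (x, x), ‖cgrad v q.1 * (q.2 - q.1)‖ < 1 / 2 :=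
    hξ.norm.eventually (gt_mem_nhds (by simp))
  have h4 : ∀ᶠ q : ℂ × ℂ in 𝓝 (x, x),
      ‖cgrad v q.1 * (q.2 - q.1)‖ * ‖cgrad v q.1‖ < ε / 4 :=
    (hξ.norm.mul hκ1.norm).eventually (gt_mem_nhds (by simpa using by linarith))
  filter_upwards [h1, h2, h3, h4] with q h1 h2 h3 h4
  set d := q.2 - q.1 with hd
  set κ := cgrad v q.1
  refine ⟨fun h0 => ?_, ?_⟩
  · have : κ * d = 1 := (sub_eq_zero.1 h0).symm
    rw [this, norm_one] at h3
    linarith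
  · have k1 := abs_log_norm_one_sub_add_re_le h3.le
    have k2 : ‖κ * d‖ ^ 2 ≤ ε / 4 * ‖d‖ := by
      calc ‖κ * d‖ ^ 2 = ‖κ * d‖ * ‖κ‖ * ‖d‖ := by rw [norm_mul]; ring
        _ ≤ _ := by gcongr
    have k3 : |((κ - cgrad v x) * d).re| ≤ ε / 4 * ‖d‖ := by
      refine (Complex.abs_re_le_norm _).trans ?_
      rw [norm_mul]; gcongr
    have k4 : |v q.1 - v q.2 + (cgrad v x * d).re| ≤ ε / 4 * ‖d‖ := by
      have e : q.1 - q.2 = -d := by rw [hd]; ring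
      rw [e, map_neg, fderiv_eq_re_cgrad, norm_neg, Real.norm_eq_abs,
        sub_neg_eq_add] at h1
      exact h1
    rw [sub_mul, Complex.sub_re] at k3
    rw [abs_le] at *
    have : 0 ≤ ε * ‖d‖ := by positivity
    constructor <;> linarith [k1.1, k1.2, k2, k3.1, k3.2, k4.1, k4.2]

/-- The discrete energy of the chain `z 0, …, z N`. -/
noncomputable def chainEnergy (v : ℂ → ℝ) (N : ℕ) (z : ℕ → ℂ) : ℝ :=
  N * ∑ i ∈ Finset.range N, Real.exp (2 * v (z i)) * Complex.normSq (z (i + 1) - z i)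

theorem chainEnergy_nonneg (v : ℂ → ℝ) (N : ℕ) (z : ℕ → ℂ) : 0 ≤ chainEnergy v N z :=
  mul_nonneg (Nat.cast_nonneg _) (Finset.sum_nonneg fun _ _ =>
    mul_nonneg (Real.exp_pos _).le (Complex.normSq_nonneg _))

theorem exp_two_mul_normSq (r : ℝ) (a : ℂ) :
    Real.exp (2 * r) * Complex.normSq a = (Real.exp r * ‖a‖) ^ 2 := by
  rw [Complex.normSq_eq_norm_sq, mul_pow, ← Real.exp_nat_mul]; norm_num

theorem sq_chainLength_le (v : ℂ → ℝ) (N : ℕ) (z : ℕ → ℂ) :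
    (∑ i ∈ Finset.range N, Real.exp (v (z i)) * ‖z (i + 1) - z i‖) ^ 2 ≤ chainEnergy v N z := by
  have h := sq_sum_le_card_mul_sum_sq (s := Finset.range N)
    (f := fun i => Real.exp (v (z i)) * ‖z (i + 1) - z i‖)
  simpa [chainEnergy, exp_two_mul_normSq] using h

theorem exists_jets_energy_term {v : ℂ → ℝ} {z : ℂ} (hv : ContDiffAt ℝ 2 v z)
    (hlap : fderiv ℝ (fderiv ℝ v) z 1 1 + fderiv ℝ (fderiv ℝ v) z Complex.I Complex.I
      = Real.exp (2 * v z))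
    {a X b P : ℂ} {n : ℝ} (hn : 0 < n) (hP : cgrad v z * X * a + b = P / n)
    (hX2 : Real.exp (v z) * ‖X‖ ≤ 2) (hP4 : Real.exp (v z) * ‖P‖ ≤ 4) :
    ∃ B C : ℂ → ℝ, (∀ θ : ℂ, HasJet (fun s => Real.exp (2 * v (z + s • (θ * X))) *
        Complex.normSq (a + s • (θ * b))) (B θ) (C θ)) ∧
      (∀ θ : ℂ, ‖θ‖ = 1 → |B θ| ≤ 8 / n * (Real.exp (v z) * ‖a‖)) ∧
      C 1 + C Complex.I ≤ 8 * (Real.exp (2 * v z) * Complex.normSq a) + 64 / n ^ 2 := by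
  choose C hC1 hC2 using fun θ : ℂ => exists_jet_energy_term hv a (θ * X) (θ * b)
  refine ⟨_, C, hC1, ?_, ?_⟩
  · intro θ hθ
    have e : cgrad v z * (θ * X) * a + θ * b = θ * (P / n) := by rw [← hP]; ring
    rw [e, abs_mul, abs_of_pos (by positivity)]
    have h1 : |(starRingEnd ℂ a * (θ * (P / n))).re| ≤ ‖a‖ * (‖P‖ / n) := by
      refine (Complex.abs_re_le_norm _).trans ?_
      rw [norm_mul, norm_mul, hθ, norm_div, RCLike.norm_conj, one_mul, Complex.norm_real,
        Real.norm_of_nonneg hn.le]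
    have h2 : Real.exp (2 * v z) = Real.exp (v z) * Real.exp (v z) := by rw [← Real.exp_add]; ring_nf
    calc 2 * Real.exp (2 * v z) * |(starRingEnd ℂ a * (θ * (P / n))).re|
        ≤ 2 * Real.exp (2 * v z) * (‖a‖ * (‖P‖ / n)) := by gcongr
      _ = 2 / n * (Real.exp (v z) * ‖a‖) * (Real.exp (v z) * ‖P‖) := by rw [h2]; ring
      _ ≤ 2 / n * (Real.exp (v z) * ‖a‖) * 4 := by gcongr
      _ = _ := by ring
  · have h1 := bilin_add_rotate (fderiv ℝ (fderiv ℝ v) z) X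
    have h2 := energy_term_laplacian (cgrad v z) X a b
    rw [hlap] at h1
    have h3 : C 1 + C Complex.I = 2 * (Real.exp (2 * v z) * Complex.normSq X) *
        (Real.exp (2 * v z) * Complex.normSq a) + 4 * (Real.exp (2 * v z) * Complex.normSq P) / n ^ 2 := by
      have h4 : Complex.normSq (P / n) = Complex.normSq P / n ^ 2 := by
        rw [Complex.normSq_div, Complex.normSq_ofReal, sq]
      rw [hP, h4] at h2
      rw [hC2, hC2, one_mul, one_mul]
      linear_combination 2 * Real.exp (2 * v z) * Complex.normSq a * h1 + Real.exp (2 * v z) * h2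
    have h5 : Real.exp (2 * v z) * Complex.normSq X ≤ 4 := by
      rw [exp_two_mul_normSq]; nlinarith [mul_nonneg (Real.exp_pos (v z)).le (norm_nonneg X)]
    have h6 : Real.exp (2 * v z) * Complex.normSq P ≤ 16 := by
      rw [exp_two_mul_normSq]; nlinarith [mul_nonneg (Real.exp_pos (v z)).le (norm_nonneg P)]
    have h7 : 0 ≤ Real.exp (2 * v z) * Complex.normSq a :=
      mul_nonneg (Real.exp_pos _).le (Complex.normSq_nonneg _)
    rw [h3]
    calc _ ≤ 2 * 4 * (Real.exp (2 * v z) * Complex.normSq a) + 4 * 16 / n ^ 2 := by gcongr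
      _ = _ := by ring

/-- Second variation of the chain energy along `i ↦ (i / N) P i`, where `P` is obtained by
discrete parallel transport. -/
theorem exists_jets_chainEnergy {v : ℂ → ℝ} {N : ℕ} (hN : 0 < N) {z P X : ℕ → ℂ}
    (hv : ∀ i < N, ContDiffAt ℝ 2 v (z i))
    (hlap : ∀ i < N, fderiv ℝ (fderiv ℝ v) (z i) 1 1 +
      fderiv ℝ (fderiv ℝ v) (z i) Complex.I Complex.I = Real.exp (2 * v (z i)))
    (hP : ∀ i < N, P (i + 1) = P i * (1 - cgrad v (z i) * (z (i + 1) - z i)))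
    (hX : ∀ i ≤ N, X i = (i / N : ℂ) * P i)
    (hP2 : ∀ i ≤ N, Real.exp (v (z i)) * ‖P i‖ ≤ 2)
    (hv2 : ∀ i < N, Real.exp (v (z i)) ≤ 2 * Real.exp (v (z (i + 1)))) :
    ∃ B C : ℂ → ℝ,
      (∀ θ : ℂ, HasJet (fun s => chainEnergy v N fun i => z i + s • (θ * X i)) (B θ) (C θ)) ∧
      (∀ θ : ℂ, ‖θ‖ = 1 → B θ ^ 2 ≤ 64 * chainEnergy v N z) ∧
      C 1 + C Complex.I ≤ 64 * (1 + chainEnergy v N z) := by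
  have hN' : (0 : ℝ) < N := by exact_mod_cast hN
  have hNc : (N : ℂ) ≠ 0 := by exact_mod_cast hN.ne'
  have hterm : ∀ i : ℕ, ∃ B C : ℂ → ℝ, i < N →
      (∀ θ : ℂ, HasJet (fun s => Real.exp (2 * v (z i + s • (θ * X i))) *
        Complex.normSq (z (i + 1) - z i + s • (θ * (X (i + 1) - X i)))) (B θ) (C θ)) ∧
      (∀ θ : ℂ, ‖θ‖ = 1 → |B θ| ≤ 8 / N * (Real.exp (v (z i)) * ‖z (i + 1) - z i‖)) ∧
      C 1 + C Complex.I ≤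
        8 * (Real.exp (2 * v (z i)) * Complex.normSq (z (i + 1) - z i)) + 64 / (N : ℝ) ^ 2 := by
    intro i
    by_cases hi : i < N
    · have h1 : cgrad v (z i) * X i * (z (i + 1) - z i) + (X (i + 1) - X i)
          = P (i + 1) / ((N : ℝ) : ℂ) := by
        rw [hX i hi.le, hX (i + 1) hi, hP i hi]
        push_cast
        field_simp
        ring
      have h2 : Real.exp (v (z i)) * ‖X i‖ ≤ 2 := by
        refine le_trans ?_ (hP2 i hi.le)
        have h3 : ‖X i‖ ≤ ‖P i‖ := by
          rw [hX i hi.le, norm_mul, norm_div, Complex.norm_natCast, Complex.norm_natCast]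
          refine mul_le_of_le_one_left (norm_nonneg _) ?_
          rw [div_le_one hN']
          exact_mod_cast hi.le
        gcongr
      have h4 : Real.exp (v (z i)) * ‖P (i + 1)‖ ≤ 4 := by
        have := mul_le_mul_of_nonneg_right (hv2 i hi) (norm_nonneg (P (i + 1)))
        linarith [hP2 (i + 1) hi]
      obtain ⟨B, C, h⟩ := exists_jets_energy_term (hv i hi) (hlap i hi) hN' h1 h2 h4
      exact ⟨B, C, fun _ => h⟩
    · exact ⟨0, 0, fun h => absurd h hi⟩
  choose B C hBC using hterm
  have hB0 : ∀ θ : ℂ, ‖θ‖ = 1 → |N * ∑ i ∈ Finset.range N, B i θ| ≤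
      8 * ∑ i ∈ Finset.range N, Real.exp (v (z i)) * ‖z (i + 1) - z i‖ := by
    intro θ hθ
    rw [abs_mul, abs_of_pos hN']
    calc _ ≤ (N : ℝ) * ∑ i ∈ Finset.range N, |B i θ| := by
          gcongr; exact Finset.abs_sum_le_sum_abs _ _
      _ ≤ (N : ℝ) * ∑ i ∈ Finset.range N, 8 / N * (Real.exp (v (z i)) * ‖z (i + 1) - z i‖) := by
          gcongr with i hi
          exact (hBC i (Finset.mem_range.1 hi)).2.1 θ hθ
      _ = _ := by rw [← Finset.mul_sum]; field_simp
  refine ⟨fun θ => N * ∑ i ∈ Finset.range N, B i θ, fun θ => N * ∑ i ∈ Finset.range N, C i θ,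
    ?_, ?_, ?_⟩
  · intro θ
    have h := (HasJet.sum (Finset.range N)
      fun i hi => (hBC i (Finset.mem_range.1 hi)).1 θ).const_mul (N : ℝ)
    convert h using 2 with s
    unfold chainEnergy
    congr 1
    refine Finset.sum_congr rfl fun i _ => ?_
    congr 2
    simp only [mul_sub, smul_sub]
    ring
  · intro θ hθ
    have h1 := sq_le_sq' (by linarith [(abs_le.1 (hB0 θ hθ)).1]) (abs_le.1 (hB0 θ hθ)).2
    refine h1.trans ?_
    rw [mul_pow]
    have := sq_chainLength_le v N z
    linarith
  · have h1 : ∑ i ∈ Finset.range N, (C i 1 + C i Complex.I) ≤ ∑ i ∈ Finset.range N,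
        (8 * (Real.exp (2 * v (z i)) * Complex.normSq (z (i + 1) - z i)) + 64 / (N : ℝ) ^ 2) :=
      Finset.sum_le_sum fun i hi => (hBC i (Finset.mem_range.1 hi)).2.2
    rw [Finset.sum_add_distrib, Finset.sum_add_distrib, ← Finset.mul_sum, Finset.sum_const,
      Finset.card_range, nsmul_eq_mul] at h1
    have h2 := mul_le_mul_of_nonneg_left h1 hN'.le
    have h3 : (N : ℝ) * (N * (64 / (N : ℝ) ^ 2)) = 64 := by field_simp
    have h4 := chainEnergy_nonneg v N z
    have h5 : chainEnergy v N z = N * ∑ i ∈ Finset.range N,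
      Real.exp (2 * v (z i)) * Complex.normSq (z (i + 1) - z i) := rfl
    simp only
    linarith

/-- Discrete parallel transport of the vector `e^{-v(z 0)}` along the chain `z`. -/
noncomputable def chainTransport (v : ℂ → ℝ) (z : ℕ → ℂ) : ℕ → ℂ
  | 0 => Real.exp (-v (z 0))
  | i + 1 => chainTransport v z i * (1 - cgrad v (z i) * (z (i + 1) - z i))

theorem chainTransport_bounds {v : ℂ → ℝ} {N : ℕ} {z : ℕ → ℂ} {ε : ℝ}
    (h : ∀ i < N, 1 - cgrad v (z i) * (z (i + 1) - z i) ≠ 0 ∧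
      |Real.log ‖1 - cgrad v (z i) * (z (i + 1) - z i)‖ + v (z (i + 1)) - v (z i)|
        ≤ ε * ‖z (i + 1) - z i‖)
    (hsum : ε * ∑ i ∈ Finset.range N, ‖z (i + 1) - z i‖ ≤ Real.log 2) (hε : 0 ≤ ε) :
    ∀ i ≤ N, Real.exp (v (z i)) * ‖chainTransport v z i‖ ≤ 2 ∧
      1 / 2 ≤ Real.exp (v (z i)) * ‖chainTransport v z i‖ := by
  have key : ∀ i ≤ N, chainTransport v z i ≠ 0 ∧ |v (z i) + Real.log ‖chainTransport v z i‖| ≤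
      ε * ∑ j ∈ Finset.range i, ‖z (j + 1) - z j‖ := by
    intro i
    induction i with
    | zero =>
      intro _
      have h0 : chainTransport v z 0 = (Real.exp (-v (z 0)) : ℝ) := rfl
      have h1 : ‖chainTransport v z 0‖ = Real.exp (-v (z 0)) := by
        rw [h0, Complex.norm_real, Real.norm_of_nonneg (Real.exp_pos _).le]
      refine ⟨norm_ne_zero_iff.1 (by rw [h1]; exact (Real.exp_pos _).ne'), ?_⟩
      rw [h1]; simp
    | succ i ih =>
      intro hi
      obtain ⟨h1, h2⟩ := ih (by omega)
      obtain ⟨h3, h4⟩ := h i (by omega)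
      rw [chainTransport, Finset.sum_range_succ, norm_mul, mul_add,
        Real.log_mul (norm_ne_zero_iff.2 h1) (norm_ne_zero_iff.2 h3)]
      refine ⟨mul_ne_zero h1 h3, ?_⟩
      rw [abs_le] at *
      constructor <;> linarith [h2.1, h2.2, h4.1, h4.2]
  intro i hi
  obtain ⟨h1, h2⟩ := key i hi
  have h3 : ε * ∑ j ∈ Finset.range i, ‖z (j + 1) - z j‖ ≤ Real.log 2 := by
    refine le_trans ?_ hsum
    gcongr
  have h4 := abs_le.1 (h2.trans h3)
  have h5 : Real.exp (v (z i)) * ‖chainTransport v z i‖ =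
      Real.exp (v (z i) + Real.log ‖chainTransport v z i‖) := by
    rw [Real.exp_add, Real.exp_log (norm_pos_iff.2 h1)]
  rw [h5]
  constructor
  · calc _ ≤ Real.exp (Real.log 2) := Real.exp_le_exp.2 h4.2
      _ = 2 := Real.exp_log two_pos
  · calc (1 : ℝ) / 2 = Real.exp (-Real.log 2) := by
          rw [Real.exp_neg, Real.exp_log two_pos]; norm_num
      _ ≤ _ := Real.exp_le_exp.2 h4.1

/-- The penalised comparison functional on chains. -/
noncomputable def chainFunctional (u v : ℂ → ℝ) (δ : ℝ) (N : ℕ) (z : ℕ → ℂ) : ℝ :=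
  (-1) * Real.exp (v (z N) - u (z N)) - δ * Real.log (1 + chainEnergy v N z)

theorem first_second_order_bound {Q δ T b w c W : ℝ} (hQ : 0 < Q) (hT : 0 < T)
    (h1 : (-1) * (Q * w) - δ * (b / T) = 0)
    (h2 : (-1) * (Q * (w ^ 2 + W)) - δ * (c / T - b ^ 2 / T ^ 2) ≤ 0) (hδ : 0 ≤ δ) :
    -(Q ^ 2 * W) ≤ δ ^ 2 * (b ^ 2 / T ^ 2) + Q * δ * (c / T) := by
  have h3 : (Q * w) ^ 2 = δ ^ 2 * (b ^ 2 / T ^ 2) := by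
    have : Q * w = -(δ * (b / T)) := by linarith
    rw [this]; ring
  have h4 := mul_le_mul_of_nonneg_left h2 hQ.le
  have h5 : 0 ≤ Q * δ * (b ^ 2 / T ^ 2) := by positivity
  nlinarith [h3, h4, h5]

theorem bound_of_chainFunctional_isLocalMax {u v : ℂ → ℝ} {N : ℕ} (hN : 0 < N) {z P X : ℕ → ℂ}
    {δ : ℝ} (hδ : 0 ≤ δ)
    (hv : ∀ i ≤ N, ContDiffAt ℝ 2 v (z i)) (hu : ContDiffAt ℝ 2 u (z N))
    (hlap : ∀ i ≤ N, fderiv ℝ (fderiv ℝ v) (z i) 1 1 +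
      fderiv ℝ (fderiv ℝ v) (z i) Complex.I Complex.I = Real.exp (2 * v (z i)))
    (hlapu : fderiv ℝ (fderiv ℝ u) (z N) 1 1 +
      fderiv ℝ (fderiv ℝ u) (z N) Complex.I Complex.I = Real.exp (2 * u (z N)))
    (hP : ∀ i < N, P (i + 1) = P i * (1 - cgrad v (z i) * (z (i + 1) - z i)))
    (hX : ∀ i ≤ N, X i = (i / N : ℂ) * P i)
    (hP2 : ∀ i ≤ N, Real.exp (v (z i)) * ‖P i‖ ≤ 2)
    (hPN : 1 / 2 ≤ Real.exp (v (z N)) * ‖P N‖)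
    (hv2 : ∀ i < N, Real.exp (v (z i)) ≤ 2 * Real.exp (v (z (i + 1))))
    (hmax : ∀ θ : ℂ, IsLocalMax (fun s : ℝ => chainFunctional u v δ N fun i => z i + s • (θ * X i)) 0)
    (hle : v (z N) ≤ u (z N)) :
    (1 - Real.exp (v (z N) - u (z N)) ^ 2) / 4 ≤ 64 * δ + 128 * δ ^ 2 := by
  obtain ⟨B, C, hjet, hB, hC⟩ := exists_jets_chainEnergy hN (fun i hi => hv i hi.le)
    (fun i hi => hlap i hi.le) hP hX hP2 hv2
  set E := chainEnergy v N z with hE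
  have hE0 : 0 ≤ E := chainEnergy_nonneg v N z
  set Q := Real.exp (v (z N) - u (z N)) with hQ
  have hQ0 : 0 < Q := Real.exp_pos _
  have hQ1 : Q ≤ 1 := Real.exp_le_one_iff.2 (by linarith)
  set W : ℂ → ℝ := fun θ => fderiv ℝ (fderiv ℝ v) (z N) (θ * X N) (θ * X N) -
    fderiv ℝ (fderiv ℝ u) (z N) (θ * X N) (θ * X N) with hW
  have hmain : ∀ θ : ℂ, -(Q ^ 2 * W θ) ≤
      δ ^ 2 * (B θ ^ 2 / (1 + E) ^ 2) + Q * δ * (C θ / (1 + E)) := by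
    intro θ
    have j1 := (((HasJet.line (hv N le_rfl) (θ * X N)).sub
      (HasJet.line hu (θ * X N))).exp).const_mul (-1)
    have e0 : (fun i => z i + (0 : ℝ) • (θ * X i)) = z := by funext i; simp
    have j2 := (((HasJet.const 1).add (hjet θ)).log (by rw [e0]; linarith)).const_mul δ
    have j3 := (j1.sub j2).of_isLocalMax (hmax θ)
    simp only [zero_smul, add_zero, zero_add] at j3
    exact first_second_order_bound hQ0 (by linarith) j3.1 j3.2 hδ
  have hXN : X N = P N := by
    have : (N : ℂ) ≠ 0 := by exact_mod_cast hN.ne'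
    rw [hX N le_rfl, div_self this, one_mul]
  have hWsum : W 1 + W Complex.I =
      Complex.normSq (P N) * (Real.exp (2 * v (z N)) - Real.exp (2 * u (z N))) := by
    have h1 := bilin_add_rotate (fderiv ℝ (fderiv ℝ v) (z N)) (P N)
    have h2 := bilin_add_rotate (fderiv ℝ (fderiv ℝ u) (z N)) (P N)
    rw [hlap N le_rfl] at h1
    rw [hlapu] at h2
    simp only [hW, hXN, one_mul]
    linarith
  have hQu : Q ^ 2 * Real.exp (2 * u (z N)) = Real.exp (2 * v (z N)) := by
    rw [hQ, ← Real.exp_nat_mul, ← Real.exp_add]; congr 1; push_cast; ring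
  have hleft : (1 - Q ^ 2) / 4 ≤ -(Q ^ 2 * (W 1 + W Complex.I)) := by
    have h1 : -(Q ^ 2 * (W 1 + W Complex.I)) =
        Real.exp (2 * v (z N)) * Complex.normSq (P N) * (1 - Q ^ 2) := by
      rw [hWsum]; linear_combination Complex.normSq (P N) * hQu
    have h2 : 1 / 4 ≤ Real.exp (2 * v (z N)) * Complex.normSq (P N) := by
      rw [exp_two_mul_normSq]; nlinarith
    have h3 : 0 ≤ 1 - Q ^ 2 := by nlinarith
    rw [h1]; nlinarith
  have hb : ∀ θ : ℂ, ‖θ‖ = 1 → B θ ^ 2 / (1 + E) ^ 2 ≤ 64 := by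
    intro θ hθ
    rw [div_le_iff₀ (by positivity)]
    nlinarith [hB θ hθ]
  have hc : C 1 / (1 + E) + C Complex.I / (1 + E) ≤ 64 := by
    rw [← add_div, div_le_iff₀ (by positivity)]; exact hC
  have k1 := hmain 1
  have k2 := hmain Complex.I
  have k3 := mul_le_mul_of_nonneg_left (hb 1 (by simp)) (sq_nonneg δ)
  have k4 := mul_le_mul_of_nonneg_left (hb Complex.I (by simp)) (sq_nonneg δ)
  have k5 := mul_le_mul_of_nonneg_left hc (mul_nonneg hQ0.le hδ)
  have k6 := mul_le_mul_of_nonneg_right hQ1 hδ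
  linarith

theorem continuousOn_chainFunctional {u v : ℂ → ℝ} {K : Set ℂ} (hu : ContinuousOn u K)
    (hv : ContinuousOn v K) (δ : ℝ) (N : ℕ) :
    ContinuousOn (chainFunctional u v δ N) {z : ℕ → ℂ | ∀ i, z i ∈ K} := by
  have hev : ∀ i, ContinuousOn (fun z : ℕ → ℂ => z i) {z : ℕ → ℂ | ∀ i, z i ∈ K} := fun i =>
    (continuous_apply i).continuousOn
  have hui : ∀ i, ContinuousOn (fun z : ℕ → ℂ => u (z i)) {z : ℕ → ℂ | ∀ i, z i ∈ K} := fun i =>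
    hu.comp (hev i) fun z hz => hz i
  have hvi : ∀ i, ContinuousOn (fun z : ℕ → ℂ => v (z i)) {z : ℕ → ℂ | ∀ i, z i ∈ K} := fun i =>
    hv.comp (hev i) fun z hz => hz i
  have hE : ContinuousOn (fun z => 1 + chainEnergy v N z) {z : ℕ → ℂ | ∀ i, z i ∈ K} := by
    refine continuousOn_const.add (continuousOn_const.mul (continuousOn_finsetSum _ fun i _ => ?_))
    exact (continuousOn_const.mul (hvi i)).rexp.mul
      (Complex.continuous_normSq.comp_continuousOn ((hev (i + 1)).sub (hev i)))
  exact (continuousOn_const.mul ((hvi N).sub (hui N)).rexp).sub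
    (continuousOn_const.mul (hE.log fun z _ => by linarith [chainEnergy_nonneg v N z]))

theorem le_of_conformallyComplete {Ω : Set ℂ} (hopen : IsOpen Ω) {u v : ℂ → ℝ}
    (hu : ContDiffOn ℝ 2 u Ω) (hv : ContDiffOn ℝ 2 v Ω)
    (hequ : ∀ z ∈ Ω, laplacianOn u Ω z = Real.exp (2 * u z))
    (heqv : ∀ z ∈ Ω, laplacianOn v Ω z = Real.exp (2 * v z))
    (hcv : ConformallyComplete v Ω) {p : ℂ} (hp : p ∈ Ω) : u p ≤ v p := by
  by_contra! hlt
  set Q₀ := Real.exp (v p - u p) with hQ₀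
  have hQ₀0 : 0 < Q₀ := Real.exp_pos _
  have hQ₀1 : Q₀ < 1 := Real.exp_lt_one_iff.2 (by linarith)
  obtain ⟨δ, hδ, hδ0⟩ : ∃ δ : ℝ, δ = (1 - Q₀ ^ 2) / 1000 ∧ 0 < δ :=
    ⟨_, rfl, div_pos (by nlinarith) (by norm_num)⟩
  have hδ1 : δ ≤ 1 := by rw [hδ]; nlinarith [sq_nonneg Q₀]
  set A := Real.exp (1 / δ) with hA
  have hA0 : 0 < A := Real.exp_pos _
  set R := A + 1 with hR
  have hR0 : 0 < R := by linarith
  obtain ⟨f, hf, hfp⟩ := hcv.exists_isShortBump hopen hv.continuousOn hp (2 * R)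
  obtain ⟨K, hK, hKΩ, hfK⟩ := hf.supp
  have hpos : ∀ z, 0 < f z → z ∈ K := fun z hz => by
    by_contra h
    exact hz.ne' (hfK z h)
  have hpK : p ∈ K := hpos p (by linarith)
  obtain ⟨m, hm0, hm⟩ : ∃ m > 0, ∀ z ∈ K, m ≤ Real.exp (v z) := by
    obtain ⟨z, hz, hmin⟩ := hK.exists_isMinOn ⟨p, hpK⟩ ((hv.continuousOn.mono hKΩ).rexp)
    exact ⟨_, Real.exp_pos (v z), fun w hw => hmin hw⟩
  set ε := m * Real.log 2 / R with hε
  have hlog2 : 0 < Real.log 2 := Real.log_pos one_lt_two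
  have hε0 : 0 < ε := by positivity
  obtain ⟨η, hη0, hη⟩ := hK.exists_uniform_radius (r := fun a b =>
    (f a - f b ≤ 2 * (Real.exp (v a) * ‖b - a‖) ∧ Real.exp (v a) ≤ 2 * Real.exp (v b)) ∧
    (1 - cgrad v a * (b - a) ≠ 0 ∧
      |Real.log ‖1 - cgrad v a * (b - a)‖ + v b - v a| ≤ ε * ‖b - a‖)) (by
    intro x hx
    obtain ⟨s, hs⟩ := exists_isGoodRadius hopen hv.continuousOn (hKΩ hx)
    have hb := Metric.closedBall_mem_nhds x hs.pos
    filter_upwards [hf.lip x (hKΩ hx), eventually_transport_estimate hopen hv (hKΩ hx) hε0,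
      prod_mem_nhds hb hb] with q h1 h2 h3
    refine ⟨⟨(le_abs_self _).trans (h1.trans ?_), hs.osc _ h3.1 _ h3.2⟩, h2⟩
    rw [dist_comm, dist_eq_norm, ← mul_assoc]
    gcongr
    exact hs.osc _ (Metric.mem_closedBall_self hs.pos.le) _ h3.1)
  obtain ⟨N, hN⟩ := exists_nat_gt (A / (m ^ 2 * η ^ 2))
  have hN' : (0 : ℝ) < N := lt_trans (by positivity) hN
  have hN0 : 0 < N := by exact_mod_cast hN'
  have hScomp : IsCompact ({z : ℕ → ℂ | ∀ i, z i ∈ K} ∩ {z | z 0 = p}) := by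
    refine IsCompact.inter_right ?_ (isClosed_eq (continuous_apply 0) continuous_const)
    have := isCompact_univ_pi fun _ : ℕ => hK
    simpa [Set.pi] using this
  obtain ⟨z, ⟨hzK, hz0⟩, hzmax⟩ := hScomp.exists_isMaxOn
    ⟨fun _ => p, fun _ => hpK, rfl⟩ ((continuousOn_chainFunctional (hu.continuousOn.mono hKΩ)
      (hv.continuousOn.mono hKΩ) δ N).mono Set.inter_subset_left)
  simp only [Set.mem_ofPred_eq] at hzK hz0
  have hE0 := chainEnergy_nonneg v N z
  have hcmp : -Q₀ ≤ -Real.exp (v (z N) - u (z N)) - δ * Real.log (1 + chainEnergy v N z) := by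
    have h1 : chainFunctional u v δ N (fun _ => p) ≤ chainFunctional u v δ N z :=
      hzmax ⟨fun _ => hpK, rfl⟩
    simpa [chainFunctional, chainEnergy] using h1
  have hlog0 : 0 ≤ δ * Real.log (1 + chainEnergy v N z) :=
    mul_nonneg hδ0.le (Real.log_nonneg (by linarith))
  have hQle : Real.exp (v (z N) - u (z N)) ≤ Q₀ := by linarith
  have hEA : chainEnergy v N z ≤ A := by
    have h1 : Real.log (1 + chainEnergy v N z) ≤ 1 / δ := by
      rw [le_div_iff₀ hδ0]
      linarith [Real.exp_pos (v (z N) - u (z N))]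
    have h2 := (Real.log_le_iff_le_exp (by linarith)).1 h1
    linarith
  have hlen : ∑ i ∈ Finset.range N, Real.exp (v (z i)) * ‖z (i + 1) - z i‖ ≤ R := by
    refine le_of_sq_le_sq ?_ hR0.le
    refine (sq_chainLength_le v N z).trans (hEA.trans ?_)
    nlinarith
  have hstep : ∀ i < N, dist (z (i + 1)) (z i) < η := by
    intro i hi
    rw [dist_eq_norm]
    refine lt_of_pow_lt_pow_left₀ 2 hη0.le ?_
    have h1 : Real.exp (2 * v (z i)) * Complex.normSq (z (i + 1) - z i) ≤
        ∑ i ∈ Finset.range N, Real.exp (2 * v (z i)) * Complex.normSq (z (i + 1) - z i) :=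
      Finset.single_le_sum (f := fun i => Real.exp (2 * v (z i)) * Complex.normSq (z (i + 1) - z i))
        (fun j _ => mul_nonneg (Real.exp_pos _).le (Complex.normSq_nonneg _)) (Finset.mem_range.2 hi)
    have h2 : N * (Real.exp (2 * v (z i)) * Complex.normSq (z (i + 1) - z i)) ≤ A :=
      (mul_le_mul_of_nonneg_left h1 hN'.le).trans hEA
    rw [exp_two_mul_normSq] at h2
    have h3 : (m * ‖z (i + 1) - z i‖) ^ 2 ≤ (Real.exp (v (z i)) * ‖z (i + 1) - z i‖) ^ 2 := by
      gcongr; exact hm _ (hzK i)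
    have h4 := mul_le_mul_of_nonneg_left h3 hN'.le
    rw [div_lt_iff₀ (by positivity)] at hN
    have h5 : (N * m ^ 2) * ‖z (i + 1) - z i‖ ^ 2 < (N * m ^ 2) * η ^ 2 := by
      rw [mul_pow] at h4; linarith
    exact lt_of_mul_lt_mul_left h5 (by positivity)
  have hest := fun i (hi : i < N) => hη (z i) (hzK i) (z (i + 1)) (hstep i hi)
  have hKint : ∀ i ≤ N, K ∈ 𝓝 (z i) := by
    have h1 : ∀ i ≤ N, f p - f (z i) ≤
        2 * ∑ j ∈ Finset.range i, Real.exp (v (z j)) * ‖z (j + 1) - z j‖ := by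
      intro i
      induction i with
      | zero => simp [hz0]
      | succ i ih =>
        intro hi
        rw [Finset.sum_range_succ]
        linarith [ih (by omega), (hest i hi).1.1]
    intro i hi
    have h2 : ∑ j ∈ Finset.range i, Real.exp (v (z j)) * ‖z (j + 1) - z j‖ ≤ R := by
      refine le_trans ?_ hlen
      gcongr
    have h3 : 0 < f (z i) := by linarith [h1 i hi]
    filter_upwards [(hf.continuousAt (hKΩ (hzK i))).eventually (lt_mem_nhds h3)] with w hw
      using hpos w hw
  have hsum : ε * ∑ i ∈ Finset.range N, ‖z (i + 1) - z i‖ ≤ Real.log 2 := by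
    have h1 : m * ∑ i ∈ Finset.range N, ‖z (i + 1) - z i‖ ≤ R := by
      refine le_trans ?_ hlen
      rw [Finset.mul_sum]
      gcongr with i hi
      exact hm _ (hzK i)
    calc _ = Real.log 2 / R * (m * ∑ i ∈ Finset.range N, ‖z (i + 1) - z i‖) := by rw [hε]; ring
      _ ≤ Real.log 2 / R * R := by gcongr
      _ = Real.log 2 := by field_simp
  have hPb := chainTransport_bounds (fun i hi => (hest i hi).2) hsum hε0.le
  set X : ℕ → ℂ := fun i => if i ≤ N then (i / N : ℂ) * chainTransport v z i else 0 with hX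
  have hmax : ∀ θ : ℂ,
      IsLocalMax (fun s : ℝ => chainFunctional u v δ N fun i => z i + s • (θ * X i)) 0 := by
    intro θ
    have h1 : ∀ i ∈ Finset.range (N + 1), ∀ᶠ s : ℝ in 𝓝 0, z i + s • (θ * X i) ∈ K := by
      intro i hi
      have hc : Tendsto (fun s : ℝ => z i + s • (θ * X i)) (𝓝 0) (𝓝 (z i)) := by
        have : Continuous fun s : ℝ => z i + s • (θ * X i) := by fun_prop
        simpa using this.tendsto 0
      exact hc.eventually (hKint i (Nat.lt_succ_iff.1 (Finset.mem_range.1 hi)))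
    filter_upwards [(Finset.eventually_all _).2 h1] with s hs
    have h2 : (fun i => z i + s • (θ * X i)) ∈ ({z : ℕ → ℂ | ∀ i, z i ∈ K} ∩ {z | z 0 = p}) := by
      refine ⟨fun i => ?_, by simp [hX, hz0]⟩
      by_cases hi : i ≤ N
      · exact hs i (Finset.mem_range.2 (Nat.lt_succ_of_le hi))
      · simpa [hX, hi] using hzK i
    have h3 := hzmax h2
    have e0 : (fun i => z i + (0 : ℝ) • (θ * X i)) = z := by funext i; simp
    rw [e0]
    exact h3
  have hzΩ : ∀ i, z i ∈ Ω := fun i => hKΩ (hzK i)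
  have hQ1 : v (z N) ≤ u (z N) := by
    have : Real.exp (v (z N) - u (z N)) < 1 := hQle.trans_lt hQ₀1
    linarith [Real.exp_lt_one_iff.1 this]
  have hfin := bound_of_chainFunctional_isLocalMax hN0 hδ0.le
    (fun i _ => hv.contDiffAt (hopen.mem_nhds (hzΩ i))) (hu.contDiffAt (hopen.mem_nhds (hzΩ N)))
    (fun i _ => by rw [← laplacianOn_eq hopen (hzΩ i), heqv _ (hzΩ i)])
    (by rw [← laplacianOn_eq hopen (hzΩ N), hequ _ (hzΩ N)])
    (P := chainTransport v z) (X := X) (fun i _ => rfl) (fun i hi => if_pos hi)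
    (fun i hi => (hPb i hi).1) (hPb N le_rfl).2 (fun i hi => (hest i hi).1.2) hmax hQ1
  have h1 : Real.exp (v (z N) - u (z N)) ^ 2 ≤ Q₀ ^ 2 := by gcongr
  have h2 : δ ^ 2 ≤ δ := by nlinarith
  linarith

/-- **Uniqueness of the Poincaré metric.** If `u` and `v` are complete C² solutions
of `Δu = e^{2u}` on a nonempty open connected set `Ω ⊆ ℂ`, then `u = v` on `Ω`. -/
theorem poincare_metric_unique
    (Ω : Set ℂ) (hne : Ω.Nonempty) (hopen : IsOpen Ω) (hconn : IsConnected Ω)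
    (u v : ℂ → ℝ) (hu : ContDiffOn ℝ 2 u Ω) (hv : ContDiffOn ℝ 2 v Ω)
    (hequ : ∀ z ∈ Ω, laplacianOn u Ω z = Real.exp (2 * u z))
    (heqv : ∀ z ∈ Ω, laplacianOn v Ω z = Real.exp (2 * v z))
    (hcu : ConformallyComplete u Ω) (hcv : ConformallyComplete v Ω) :
    ∀ z ∈ Ω, u z = v z := by
  intro z hz
  exact le_antisymm (le_of_conformallyComplete hopen hu hv hequ heqv hcv hz)
    (le_of_conformallyComplete hopen hv hu heqv hequ hcu hz)
end

section
/- (Comparison principle for the curvature equation) Let Ω ⊆ ℂ be a bounded open set and let K₀ : Ω → ℝ be a function. Suppose u, v are continuous on the closure of Ω, C² on Ω, and satisfy Δu − e^{2u} = K₀ and Δv − e^{2v} = K₀ on Ω. If u ≤ v on the boundary ∂Ω, then u ≤ v on all of Ω. -/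
/-- The second derivative of a `C²` function at a local maximum is nonpositive on the diagonal. -/
theorem IsLocalMax.iteratedFDeriv_two_nonpos {E : Type*} [NormedAddCommGroup E] [NormedSpace ℝ E]
    {f : E → ℝ} {z : E} (hmax : IsLocalMax f z) (hf : ContDiffAt ℝ 2 f z) (e : E) :
    iteratedFDeriv ℝ 2 f z ![e, e] ≤ 0 := by
  set γ : ℝ → E := fun t => z + t • e with hγ
  have hγ0 : γ 0 = z := by simp [hγ]
  have hγd : ∀ t, HasDerivAt γ e t := fun t => by
    have h := (hasDerivAt_id t).smul_const e
    rw [one_smul] at h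
    exact h.const_add z
  have hγt : Filter.Tendsto γ (nhds 0) (nhds z) := by
    simpa only [hγ0] using (hγd 0).continuousAt.tendsto
  have hdf : ∀ᶠ y in nhds z, DifferentiableAt ℝ f y :=
    (hf.eventually (by simp)).mono fun y hy => hy.differentiableAt (by simp)
  have hd1 : deriv (f ∘ γ) =ᶠ[nhds 0] fun t => fderiv ℝ f (γ t) e :=
    (hγt.eventually hdf).mono fun t ht => (ht.hasFDerivAt.comp_hasDerivAt t (hγd t)).deriv
  have hdd : DifferentiableAt ℝ (fderiv ℝ f) (γ 0) := by
    rw [hγ0]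
    exact (hf.fderiv_right (m := 1) (by norm_num)).differentiableAt (by simp)
  have hd2 : deriv (deriv (f ∘ γ)) 0 = fderiv ℝ (fderiv ℝ f) z e e := by
    rw [hd1.deriv_eq]
    have h := (hdd.hasFDerivAt.comp_hasDerivAt 0 (hγd 0)).clm_apply (hasDerivAt_const 0 e)
    simpa [hγ0] using h.deriv
  have hgmax : IsLocalMax (f ∘ γ) 0 := by
    have h : ∀ᶠ t in nhds 0, f (γ t) ≤ f z := hγt.eventually hmax
    simpa [IsLocalMax, IsMaxFilter, hγ0] using h
  rw [iteratedFDeriv_two_apply]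
  simp only [Matrix.cons_val_zero, Matrix.cons_val_one]
  by_contra! hpos
  rw [← hd2] at hpos
  have hgcont : ContinuousAt (f ∘ γ) 0 := by
    refine ContinuousAt.comp ?_ (hγd 0).continuousAt
    rw [hγ0]
    exact hf.continuousAt
  have hgmin := isLocalMin_of_deriv_deriv_pos hpos hgmax.deriv_eq_zero hgcont
  have hconst : f ∘ γ =ᶠ[nhds 0] fun _ => (f ∘ γ) 0 := by
    filter_upwards [hgmax, hgmin] with t h₁ h₂ using le_antisymm h₁ h₂
  rw [hconst.deriv.deriv_eq] at hpos
  simp at hpos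

/-- The Laplacian of a `C²` function is nonpositive at an interior local maximum. -/
theorem laplacianOn_nonpos_of_isLocalMax {f : ℂ → ℝ} {s : Set ℂ} {z : ℂ} (hs : IsOpen s)
    (hz : z ∈ s) (hf : ContDiffOn ℝ 2 f s) (hmax : IsLocalMax f z) : laplacianOn f s z ≤ 0 := by
  have hfz := hf.contDiffAt (hs.mem_nhds hz)
  rw [laplacianOn, iteratedFDerivWithin_of_isOpen 2 hs hz]
  exact add_nonpos (hmax.iteratedFDeriv_two_nonpos hfz 1)
    (hmax.iteratedFDeriv_two_nonpos hfz Complex.I)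

/-- The Laplacian of a difference of `C²` functions is the difference of the Laplacians. -/
theorem laplacianOn_sub {f g : ℂ → ℝ} {s : Set ℂ} {z : ℂ} (hs : IsOpen s) (hz : z ∈ s)
    (hf : ContDiffOn ℝ 2 f s) (hg : ContDiffOn ℝ 2 g s) :
    laplacianOn (f - g) s z = laplacianOn f s z - laplacianOn g s z := by
  simp only [laplacianOn]
  rw [iteratedFDerivWithin_sub_apply (hf z hz) (hg z hz) hs.uniqueDiffOn hz]
  simp only [sub_apply]
  ring

/-- **Comparison principle for the curvature equation.** If `u, v` are continuous on
the closure of a bounded open set `Ω ⊆ ℂ`, are C² on `Ω`, solve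
`Δu - e^{2u} = K₀ = Δv - e^{2v}` on `Ω`, and `u ≤ v` on `∂Ω`, then `u ≤ v` on `Ω`. -/
theorem curvature_equation_comparison
    (Ω : Set ℂ) (hbdd : Bornology.IsBounded Ω) (hopen : IsOpen Ω)
    (K₀ u v : ℂ → ℝ)
    (hucont : ContinuousOn u (closure Ω)) (hvcont : ContinuousOn v (closure Ω))
    (huC2 : ContDiffOn ℝ 2 u Ω) (hvC2 : ContDiffOn ℝ 2 v Ω)
    (hequ : ∀ z ∈ Ω, laplacianOn u Ω z - Real.exp (2 * u z) = K₀ z)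
    (heqv : ∀ z ∈ Ω, laplacianOn v Ω z - Real.exp (2 * v z) = K₀ z)
    (hboundary : ∀ z ∈ frontier Ω, u z ≤ v z) :
    ∀ z ∈ Ω, u z ≤ v z := by
  intro z hz
  obtain ⟨m, hm, hmax⟩ := hbdd.isCompact_closure.exists_isMaxOn ⟨z, subset_closure hz⟩
    (hucont.sub hvcont)
  by_contra! hlt
  have hzm : u z - v z ≤ u m - v m := hmax (subset_closure hz)
  have hmΩ : m ∈ Ω := by
    by_contra hnot
    have := hboundary m (by rw [hopen.frontier_eq]; exact ⟨hm, hnot⟩)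
    linarith
  have hloc : IsLocalMax (u - v) m :=
    hmax.isLocalMax (Filter.mem_of_superset (hopen.mem_nhds hmΩ) subset_closure)
  have hlap : laplacianOn (u - v) Ω m ≤ 0 :=
    laplacianOn_nonpos_of_isLocalMax hopen hmΩ (huC2.sub hvC2) hloc
  rw [laplacianOn_sub hopen hmΩ huC2 hvC2] at hlap
  have hexp : Real.exp (2 * v m) < Real.exp (2 * u m) := Real.exp_lt_exp.mpr (by linarith)
  linarith [hequ m hmΩ, heqv m hmΩ]
end

section
/- Let Ω ⊊ ℂ be a nonempty open proper subset of ℂ, and let u : Ω → ℝ be a C² function satisfying Δu ≥ e^{2u} on Ω. Then for every p ∈ Ω, e^{2u(p)} ≤ 4/δ(p)², where δ(p) = dist(p, ℂ \ Ω) = inf{|p − q| : q ∈ ℂ \ Ω}. -/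
open Filter Topology in
/-- Second-order necessary condition at a local maximum on the real line. -/
theorem IsLocalMax.second_deriv_nonpos {f f' : ℝ → ℝ} {x c : ℝ} (hmax : IsLocalMax f x)
    (hf : ∀ᶠ t in 𝓝 x, HasDerivAt f (f' t) t) (hf' : HasDerivAt f' c x) : c ≤ 0 := by
  by_contra! hc
  have hderiv : deriv f =ᶠ[𝓝 x] f' := hf.mono fun t ht => ht.deriv
  have hsecond : deriv (deriv f) x = c := by rw [hderiv.deriv_eq, hf'.deriv]
  have hmin : IsLocalMin f x :=
    isLocalMin_of_deriv_deriv_pos (hsecond ▸ hc) hmax.deriv_eq_zero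
      hf.self_of_nhds.continuousAt
  have hconst : f =ᶠ[𝓝 x] fun _ => f x := by
    filter_upwards [hmax, hmin] with t h₁ h₂ using le_antisymm h₁ h₂
  have hzero : deriv (deriv f) x = 0 := by
    rw [hconst.deriv.deriv_eq]
    simp
  linarith

open Filter Topology in
/-- At a local maximum of `u + log (r² - |z - p|²)`, the second derivative of `u` in a unit
direction is bounded by minus that of the logarithmic term. -/
theorem iteratedFDeriv_two_le_of_isLocalMax_add_log {u : ℂ → ℝ} {p q v : ℂ} {r A b : ℝ}
    (hu : ContDiffAt ℝ 2 u q) (hA : 0 < A)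
    (hquad : ∀ t : ℝ, r ^ 2 - ‖q + t • v - p‖ ^ 2 = A - 2 * b * t - t ^ 2)
    (hmax : IsLocalMax (fun z => u z + Real.log (r ^ 2 - ‖z - p‖ ^ 2)) q) :
    iteratedFDeriv ℝ 2 u q ![v, v] ≤ (2 * A + 4 * b ^ 2) / A ^ 2 := by
  have hline : ∀ t : ℝ, HasDerivAt (fun t : ℝ => q + t • v) v t := fun t => by
    simpa using ((hasDerivAt_id t).smul_const v).const_add q
  have hline_tendsto : Tendsto (fun t : ℝ => q + t • v) (𝓝 0) (𝓝 q) := by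
    simpa using (hline 0).continuousAt.tendsto
  have hquad_deriv : ∀ t : ℝ,
      HasDerivAt (fun t : ℝ => A - 2 * b * t - t ^ 2) (-2 * b - 2 * t) t := fun t => by
    refine ((((hasDerivAt_id t).const_mul (2 * b)).const_sub A).sub
      (hasDerivAt_pow 2 t)).congr_deriv ?_
    norm_num
  have hquad_pos : ∀ᶠ t in 𝓝 (0 : ℝ), 0 < A - 2 * b * t - t ^ 2 :=
    (hquad_deriv 0).continuousAt.eventually (lt_mem_nhds (by simpa using hA))
  have hu_diff : ∀ᶠ z in 𝓝 q, DifferentiableAt ℝ u z :=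
    (hu.eventually (by simp)).mono fun z hz => hz.differentiableAt (by norm_num)
  have hfirst : ∀ᶠ t in 𝓝 (0 : ℝ),
      HasDerivAt (fun t : ℝ => u (q + t • v) + Real.log (A - 2 * b * t - t ^ 2))
        (fderiv ℝ u (q + t • v) v + (-2 * b - 2 * t) / (A - 2 * b * t - t ^ 2)) t := by
    filter_upwards [hquad_pos, hline_tendsto.eventually hu_diff] with t ht hut
    exact (hut.hasFDerivAt.comp_hasDerivAt t (hline t)).add ((hquad_deriv t).log ht.ne')
  have hfderiv : HasFDerivAt (fderiv ℝ u) (fderiv ℝ (fderiv ℝ u) q) (q + (0 : ℝ) • v) := by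
    simpa using ((hu.fderiv_right (m := 1) (by norm_num)).differentiableAt
      (by norm_num)).hasFDerivAt
  have hsecond : HasDerivAt
      (fun t : ℝ => fderiv ℝ u (q + t • v) v + (-2 * b - 2 * t) / (A - 2 * b * t - t ^ 2))
      (fderiv ℝ (fderiv ℝ u) q v v - (2 * A + 4 * b ^ 2) / A ^ 2) 0 := by
    have h₀ : HasDerivAt (fun t : ℝ => fderiv ℝ u (q + t • v)) (fderiv ℝ (fderiv ℝ u) q v) 0 :=
      hfderiv.comp_hasDerivAt (0 : ℝ) (hline 0)
    have h₁ : HasDerivAt (fun t : ℝ => fderiv ℝ u (q + t • v) v)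
        (fderiv ℝ (fderiv ℝ u) q v v) 0 :=
      (ContinuousLinearMap.apply ℝ ℝ v).hasFDerivAt.comp_hasDerivAt (0 : ℝ) h₀
    have h₂ : HasDerivAt (fun t : ℝ => (-2 * b - 2 * t) / (A - 2 * b * t - t ^ 2))
        (-((2 * A + 4 * b ^ 2) / A ^ 2)) 0 := by
      refine ((((hasDerivAt_id (0 : ℝ)).const_mul 2).const_sub (-2 * b)).div (hquad_deriv 0)
        (by simpa using hA.ne')).congr_deriv ?_
      simp
      ring
    exact (h₁.add h₂).congr_deriv (sub_eq_add_neg _ _).symm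
  have hmax_line : IsLocalMax
      (fun t : ℝ => u (q + t • v) + Real.log (A - 2 * b * t - t ^ 2)) 0 := by
    filter_upwards [hline_tendsto.eventually hmax] with t ht
    have h₀ := hquad 0
    simp only [zero_smul, add_zero] at h₀
    simpa only [hquad, zero_smul, add_zero, h₀] using ht
  rw [iteratedFDeriv_two_apply]
  simpa using hmax_line.second_deriv_nonpos hfirst hsecond

open Filter Topology in
/-- The upper bound for `exp u` at the centre of a closed disk on which `u` is `C²` and
`exp (2 * u) ≤ Δ u`. -/
theorem exp_mul_le_two_of_exp_le_laplacian {u : ℂ → ℝ} {p : ℂ} {r : ℝ} (hr : 0 < r)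
    (hu : ∀ z ∈ Metric.closedBall p r, ContDiffAt ℝ 2 u z)
    (hineq : ∀ z ∈ Metric.ball p r, Real.exp (2 * u z) ≤
      iteratedFDeriv ℝ 2 u z ![1, 1] + iteratedFDeriv ℝ 2 u z ![Complex.I, Complex.I]) :
    Real.exp (u p) * r ≤ 2 := by
  set F : ℂ → ℝ := fun z => Real.exp (u z) * (r ^ 2 - ‖z - p‖ ^ 2) with hF
  have hcont : ContinuousOn F (Metric.closedBall p r) := by
    have huc : ContinuousOn u (Metric.closedBall p r) :=
      fun z hz => (hu z hz).continuousAt.continuousWithinAt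
    fun_prop
  have hp : p ∈ Metric.closedBall p r := Metric.mem_closedBall_self hr.le
  obtain ⟨q, hq, hqmax⟩ := (isCompact_closedBall p r).exists_isMaxOn ⟨p, hp⟩ hcont
  have hFp : F p = Real.exp (u p) * r ^ 2 := by simp [hF]
  have hle : F p ≤ F q := hqmax hp
  have hA : 0 < r ^ 2 - ‖q - p‖ ^ 2 := by
    have h : 0 < F q := lt_of_lt_of_le (hFp ▸ by positivity) hle
    exact pos_of_mul_pos_right h (Real.exp_pos _).le
  have hball : ∀ z, z ∈ Metric.ball p r → 0 < r ^ 2 - ‖z - p‖ ^ 2 := fun z hz => by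
    rw [mem_ball_iff_norm] at hz
    nlinarith [norm_nonneg (z - p)]
  have hqball : q ∈ Metric.ball p r := by
    rw [mem_ball_iff_norm]
    exact lt_of_pow_lt_pow_left₀ 2 hr.le (by linarith)
  have hmax : IsLocalMax (fun z => u z + Real.log (r ^ 2 - ‖z - p‖ ^ 2)) q := by
    filter_upwards [Metric.isOpen_ball.mem_nhds hqball] with z hz
    have hzq : F z ≤ F q := hqmax (Metric.ball_subset_closedBall hz)
    have hz0 := hball z hz
    have h := Real.log_le_log (mul_pos (Real.exp_pos _) hz0) hzq
    rwa [Real.log_mul (Real.exp_ne_zero _) hz0.ne', Real.log_mul (Real.exp_ne_zero _) hA.ne',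
      Real.log_exp, Real.log_exp] at h
  have hnorm : ∀ z : ℂ, ‖z‖ ^ 2 = z.re ^ 2 + z.im ^ 2 := fun z => by
    rw [Complex.sq_norm, Complex.normSq_apply]
    ring
  have h₁ := iteratedFDeriv_two_le_of_isLocalMax_add_log (v := 1) (b := (q - p).re)
    (hu q hq) hA (fun t => by simp [hnorm]; ring) hmax
  have h₂ := iteratedFDeriv_two_le_of_isLocalMax_add_log (v := Complex.I) (b := (q - p).im)
    (hu q hq) hA (fun t => by simp [hnorm]; ring) hmax
  have hexp : Real.exp (2 * u q) ≤ 4 * r ^ 2 / (r ^ 2 - ‖q - p‖ ^ 2) ^ 2 := by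
    refine (hineq q hqball).trans ((add_le_add h₁ h₂).trans_eq ?_)
    rw [← add_div]
    congr 1
    linear_combination (-4 : ℝ) * hnorm (q - p)
  have hFq : F q ≤ 2 * r := by
    refine (abs_le_of_sq_le_sq' ?_ (by positivity)).2
    rw [le_div_iff₀ (by positivity), mul_comm (2 : ℝ), Real.exp_mul] at hexp
    norm_cast at hexp
    calc F q ^ 2 = Real.exp (u q) ^ 2 * (r ^ 2 - ‖q - p‖ ^ 2) ^ 2 := by simp only [hF]; ring
      _ ≤ 4 * r ^ 2 := hexp
      _ = (2 * r) ^ 2 := by ring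
  refine le_of_mul_le_mul_right ?_ hr
  linarith [hle.trans hFq]


/-- If `Ω ⊊ ℂ` is a nonempty proper open subset and `u` is C² on `Ω` with
`Δu ≥ e^{2u}`, then `e^{2u(p)} ≤ 4/δ(p)²` for all `p ∈ Ω`, where
`δ(p) = dist(p, ℂ \ Ω)`. -/
theorem conformal_factor_upper_bound
    (Ω : Set ℂ) (hne : Ω.Nonempty) (hopen : IsOpen Ω) (hproper : Ω ≠ Set.univ)
    (u : ℂ → ℝ) (hu : ContDiffOn ℝ 2 u Ω)
    (hineq : ∀ z ∈ Ω, Real.exp (2 * u z) ≤ laplacianOn u Ω z) :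
    ∀ p ∈ Ω, Real.exp (2 * u p) ≤ 4 / (Metric.infDist p Ωᶜ) ^ 2 := by
  intro p hp
  have hδ : 0 < Metric.infDist p Ωᶜ :=
    (hopen.isClosed_compl.notMem_iff_infDist_pos (Set.nonempty_compl.2 hproper)).1 (by simpa)
  have hbound : ∀ r ∈ Set.Ioo 0 (Metric.infDist p Ωᶜ), Real.exp (u p) * r ≤ 2 := by
    intro r hr
    have hsub : Metric.closedBall p r ⊆ Ω := fun z hz => by
      by_contra hzΩ
      have := Metric.infDist_le_dist_of_mem (x := p) (Set.mem_compl hzΩ)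
      rw [Metric.mem_closedBall, dist_comm] at hz
      linarith [hr.2]
    refine exp_mul_le_two_of_exp_le_laplacian hr.1
      (fun z hz => hu.contDiffAt (hopen.mem_nhds (hsub hz))) fun z hz => ?_
    have hzΩ := hsub (Metric.ball_subset_closedBall hz)
    simpa only [laplacianOn, iteratedFDerivWithin_of_isOpen 2 hopen hzΩ] using hineq z hzΩ
  have hlimit : Real.exp (u p) * Metric.infDist p Ωᶜ ≤ 2 := by
    rw [← le_div_iff₀' (Real.exp_pos _)]
    refine le_of_forall_lt_imp_le_of_dense fun r hr => ?_
    rcases le_or_gt r 0 with h | h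
    · exact h.trans (by positivity)
    · exact (le_div_iff₀' (Real.exp_pos _)).2 (hbound r ⟨h, hr⟩)
  rw [le_div_iff₀ (by positivity), mul_comm (2 : ℝ), Real.exp_mul]
  norm_cast
  rw [← mul_pow]
  exact (pow_le_pow_left₀ (by positivity) hlimit 2).trans_eq (by norm_num)
end

section
/- Let Ω ⊆ ℂ be a bounded open connected set, and suppose there exists r > 0 such that for every boundary point p ∈ ∂Ω there are closed disks D_in and D_out, each of radius r and each containing p on its boundary circle, with D_in contained in the closure of Ω and D_out contained in ℂ \ Ω. Let u : Ω → ℝ be a C² function with Δu = e^{2u} on Ω which is complete, i.e. every continuous piecewise-C¹ path γ : [0,1) → Ω that eventually leaves every compact subset of Ω has infinite length ∫₀¹ e^{u(γ(t))}|γ'(t)| dt. Then δ(p)²·e^{2u(p)} → 1 as p → ∂Ω, where δ(p) = dist(p, ∂Ω): for every ε > 0 there is η > 0 such that δ(p) < η implies |δ(p)²·e^{2u(p)} − 1| < ε. -/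
section

open Set Filter Topology Metric
open scoped Laplacian

theorem ContDiffAt.laplacian_complex_eq_deriv {f : ℂ → ℝ} {x : ℂ} (hf : ContDiffAt ℝ 2 f x) :
    Δ f x = deriv (deriv fun t : ℝ => f (x + t)) 0 +
      deriv (deriv fun t : ℝ => f (x + t * Complex.I)) 0 := by
  have key : ∀ e : ℂ, iteratedFDeriv ℝ 2 f x ![e, e]
      = deriv (deriv fun t : ℝ => f (x + t * e)) 0 := by
    intro e
    have hline : ∀ t : ℝ, HasDerivAt (fun t : ℝ => x + t * e) e t := fun t => by
      simpa using ((Complex.ofRealCLM.hasDerivAt (x := t)).mul_const e).const_add x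
    have hcont : Tendsto (fun t : ℝ => x + t * e) (𝓝 0) (𝓝 x) := by
      have := (hline 0).continuousAt.tendsto
      simpa using this
    have h1 : deriv (fun t : ℝ => f (x + t * e)) =ᶠ[𝓝 0]
        fun t : ℝ => fderiv ℝ f (x + t * e) e := by
      have h2 : ∀ᶠ y in 𝓝 x, ContDiffAt ℝ 2 f y := hf.eventually (by simp)
      filter_upwards [hcont.eventually h2] with t ht
      exact ((ht.differentiableAt (by simp)).hasFDerivAt.comp_hasDerivAt t (hline t)).deriv
    rw [h1.deriv_eq]
    have h3 : DifferentiableAt ℝ (fderiv ℝ f) x :=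
      (hf.fderiv_right (m := 1) (by norm_num)).differentiableAt (by simp)
    have h4 : HasDerivAt (fun t : ℝ => fderiv ℝ f (x + t * e)) (fderiv ℝ (fderiv ℝ f) x e) 0 :=
      h3.hasFDerivAt.comp_hasDerivAt_of_eq (0 : ℝ) (hline 0) (by simp)
    have h5 : HasDerivAt (fun t : ℝ => fderiv ℝ f (x + t * e) e)
        (fderiv ℝ (fderiv ℝ f) x e e) 0 :=
      (ContinuousLinearMap.apply ℝ ℝ e).hasFDerivAt.comp_hasDerivAt (0 : ℝ) h4
    rw [h5.deriv, iteratedFDeriv_two_apply]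
    rfl
  rw [InnerProductSpace.laplacian_eq_iteratedFDeriv_complexPlane]
  simp only [key]
  simp

theorem laplacianOn_eq_laplacian {u : ℂ → ℝ} {s : Set ℂ} (hs : IsOpen s) {z : ℂ} (hz : z ∈ s) :
    laplacianOn u s z = Δ u z := by
  rw [laplacianOn, iteratedFDerivWithin_of_isOpen 2 hs hz,
    InnerProductSpace.laplacian_eq_iteratedFDeriv_complexPlane]

theorem IsLocalMax.deriv_deriv_nonpos {f : ℝ → ℝ} {a : ℝ} (h : IsLocalMax f a)
    (hc : ContinuousAt f a) : deriv (deriv f) a ≤ 0 := by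
  by_contra! hpos
  have hmin : IsLocalMin f a := isLocalMin_of_deriv_deriv_pos hpos h.deriv_eq_zero hc
  have hconst : f =ᶠ[𝓝 a] fun _ => f a := by
    filter_upwards [h, hmin] with t h1 h2 using le_antisymm h1 h2
  have : deriv (deriv f) a = 0 := by
    rw [hconst.deriv.deriv_eq]; simp
  exact hpos.ne' this

theorem IsLocalMax.laplacian_nonpos {f : ℂ → ℝ} {x : ℂ} (h : IsLocalMax f x)
    (hf : ContDiffAt ℝ 2 f x) : Δ f x ≤ 0 := by
  rw [hf.laplacian_complex_eq_deriv]
  have key : ∀ e : ℂ, deriv (deriv fun t : ℝ => f (x + t * e)) 0 ≤ 0 := by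
    intro e
    have hc : ContinuousAt (fun t : ℝ => x + t * e) 0 := by fun_prop
    have hx : x + (0 : ℝ) * e = x := by simp
    refine IsLocalMax.deriv_deriv_nonpos ?_ ?_
    · have hc' : Tendsto (fun t : ℝ => x + t * e) (𝓝 0) (𝓝 x) := by
        simpa using hc.tendsto
      filter_upwards [hc'.eventually h] with t ht
      simpa using ht
    · refine ContinuousAt.comp (f := fun t : ℝ => x + t * e) ?_ hc
      rw [hx]; exact hf.continuousAt
  have h1 := key 1
  have h2 := key Complex.I
  simp only [mul_one] at h1
  linarith

theorem deriv_deriv_quadratic (a b : ℝ) :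
    deriv (deriv fun t : ℝ => a + b * t + t ^ 2) 0 = 2 := by
  have h : deriv (fun t : ℝ => a + b * t + t ^ 2) = fun t => b + 2 * t := by
    ext t
    have := (((hasDerivAt_id t).const_mul b).const_add a).fun_add (hasDerivAt_pow 2 t)
    simpa using this.deriv
  rw [h]
  simp

theorem deriv_deriv_log_quadratic {a : ℝ} (ha : a ≠ 0) (b : ℝ) :
    deriv (deriv fun t : ℝ => Real.log (a + b * t + t ^ 2)) 0 = 2 / a - b ^ 2 / a ^ 2 := by
  have hq : ∀ t : ℝ, HasDerivAt (fun t : ℝ => a + b * t + t ^ 2) (b + 2 * t) t := fun t => by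
    have := (((hasDerivAt_id t).const_mul b).const_add a).fun_add (hasDerivAt_pow 2 t)
    simpa using this
  have h : deriv (fun t : ℝ => Real.log (a + b * t + t ^ 2)) =ᶠ[𝓝 0]
      fun t => (b + 2 * t) / (a + b * t + t ^ 2) := by
    have h0 : ∀ᶠ t in 𝓝 (0 : ℝ), a + b * t + t ^ 2 ≠ 0 := by
      have : ContinuousAt (fun t : ℝ => a + b * t + t ^ 2) 0 := by fun_prop
      exact this.eventually_ne (by simpa using ha)
    filter_upwards [h0] with t ht using ((hq t).log ht).deriv
  rw [h.deriv_eq]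
  have h1 : HasDerivAt (fun t : ℝ => b + 2 * t) 2 0 := by
    simpa using ((hasDerivAt_id (0 : ℝ)).const_mul 2).const_add b
  rw [(h1.fun_div (hq 0) (by simpa using ha)).deriv]
  simp only [mul_zero, add_zero, ne_eq, OfNat.ofNat_ne_zero, not_false_eq_true, zero_pow]
  field_simp

theorem norm_sub_sq_add_ofReal (x c : ℂ) (t : ℝ) :
    ‖x + t - c‖ ^ 2 = ‖x - c‖ ^ 2 + 2 * (x - c).re * t + t ^ 2 := by
  simp only [Complex.sq_norm, Complex.normSq_apply, Complex.add_re, Complex.sub_re,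
    Complex.ofReal_re, Complex.add_im, Complex.sub_im, Complex.ofReal_im]
  ring

theorem norm_sub_sq_add_ofReal_mul_I (x c : ℂ) (t : ℝ) :
    ‖x + t * Complex.I - c‖ ^ 2 = ‖x - c‖ ^ 2 + 2 * (x - c).im * t + t ^ 2 := by
  simp only [Complex.sq_norm, Complex.normSq_apply, Complex.add_re, Complex.sub_re,
    Complex.re_ofReal_mul, Complex.im_ofReal_mul, Complex.add_im, Complex.sub_im, Complex.I_re,
    Complex.I_im]
  ring

theorem contDiff_norm_sub_sq (c : ℂ) : ContDiff ℝ 2 fun x : ℂ => ‖x - c‖ ^ 2 :=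
  (contDiff_id.sub contDiff_const).norm_sq ℝ

theorem laplacian_norm_sub_sq (c x : ℂ) : Δ (fun y : ℂ => ‖y - c‖ ^ 2) x = 4 := by
  rw [(contDiff_norm_sub_sq c).contDiffAt.laplacian_complex_eq_deriv]
  simp only [norm_sub_sq_add_ofReal, norm_sub_sq_add_ofReal_mul_I, deriv_deriv_quadratic]
  norm_num

theorem contDiffAt_log_norm_sub_sq {c x : ℂ} {R : ℝ} (h : ‖x - c‖ ^ 2 - R ^ 2 ≠ 0) :
    ContDiffAt ℝ 2 (fun y : ℂ => Real.log (‖y - c‖ ^ 2 - R ^ 2)) x :=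
  ((contDiff_norm_sub_sq c).contDiffAt.sub contDiffAt_const).log h

theorem laplacian_log_norm_sub_sq {c x : ℂ} {R : ℝ} (h : ‖x - c‖ ^ 2 - R ^ 2 ≠ 0) :
    Δ (fun y : ℂ => Real.log (‖y - c‖ ^ 2 - R ^ 2)) x
      = -(4 * R ^ 2) / (‖x - c‖ ^ 2 - R ^ 2) ^ 2 := by
  rw [(contDiffAt_log_norm_sub_sq h).laplacian_complex_eq_deriv]
  have e : ∀ b t : ℝ, ‖x - c‖ ^ 2 + b * t + t ^ 2 - R ^ 2
      = (‖x - c‖ ^ 2 - R ^ 2) + b * t + t ^ 2 := fun b t => by ring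
  simp only [norm_sub_sq_add_ofReal, norm_sub_sq_add_ofReal_mul_I, e, deriv_deriv_log_quadratic h]
  have hn : ‖x - c‖ ^ 2 = (x - c).re ^ 2 + (x - c).im ^ 2 := by
    rw [Complex.sq_norm, Complex.normSq_apply]; ring
  generalize (x - c).re = p at *
  generalize (x - c).im = q at *
  field_simp
  rw [hn]
  ring

theorem exists_mem_sphere_of_lt_laplacian {φ : ℂ → ℝ} {z x₀ : ℂ} {s k : ℝ}
    (hc : ContinuousOn φ (closedBall z s)) (hφ : ∀ x ∈ ball z s, ContDiffAt ℝ 2 φ x)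
    (hx₀ : x₀ ∈ ball z s)
    (hΔ : ∀ x ∈ ball z s, φ x₀ - k * ‖x₀ - z‖ ^ 2 ≤ φ x - k * ‖x - z‖ ^ 2 → 4 * k < Δ φ x) :
    ∃ y ∈ sphere z s, φ x₀ - k * ‖x₀ - z‖ ^ 2 ≤ φ y - k * s ^ 2 := by
  have hg : ContinuousOn (fun x => φ x - k * ‖x - z‖ ^ 2) (closedBall z s) :=
    hc.sub (by fun_prop)
  obtain ⟨y, hy, hmax⟩ := (isCompact_closedBall z s).exists_isMaxOn
    ⟨x₀, ball_subset_closedBall hx₀⟩ hg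
  have hle := hmax (ball_subset_closedBall hx₀)
  simp only [Set.mem_ofPred_eq] at hle
  by_cases hys : y ∈ sphere z s
  · refine ⟨y, hys, ?_⟩
    rwa [← mem_sphere_iff_norm.1 hys]
  · exfalso
    have hyb : y ∈ ball z s := lt_of_le_of_ne hy hys
    have hloc : IsLocalMax (fun x => φ x - k * ‖x - z‖ ^ 2) y :=
      hmax.isLocalMax (Filter.mem_of_superset (isOpen_ball.mem_nhds hyb) ball_subset_closedBall)
    have h1 : ContDiffAt ℝ 2 (k • fun x : ℂ => ‖x - z‖ ^ 2) y :=
      (contDiff_norm_sub_sq z).contDiffAt.const_smul k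
    have h2 : ContDiffAt ℝ 2 (φ - k • fun x : ℂ => ‖x - z‖ ^ 2) y := (hφ y hyb).sub h1
    have h3 : Δ (φ - k • fun x : ℂ => ‖x - z‖ ^ 2) y ≤ 0 := IsLocalMax.laplacian_nonpos hloc h2
    rw [(hφ y hyb).laplacian_sub h1,
      InnerProductSpace.laplacian_smul k (contDiff_norm_sub_sq z).contDiffAt,
      laplacian_norm_sub_sq, smul_eq_mul] at h3
    have := hΔ y hyb hle
    linarith

theorem le_of_laplacian_nonneg {φ : ℂ → ℝ} {z x : ℂ} {s M : ℝ}
    (hc : ContinuousOn φ (closedBall z s)) (hφ : ∀ x ∈ ball z s, ContDiffAt ℝ 2 φ x)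
    (hΔ : ∀ x ∈ ball z s, 0 ≤ Δ φ x) (hM : ∀ y ∈ sphere z s, φ y ≤ M)
    (hx : x ∈ closedBall z s) : φ x ≤ M := by
  by_cases hxs : x ∈ sphere z s
  · exact hM x hxs
  have hxb : x ∈ ball z s := lt_of_le_of_ne hx hxs
  refine le_of_forall_pos_le_add fun ε hε => ?_
  have hs : 0 < s := pos_of_mem_ball hxb
  obtain ⟨y, hy, h⟩ := exists_mem_sphere_of_lt_laplacian (k := -(ε / s ^ 2)) hc hφ hxb
    (fun w hw _ => by
      have := hΔ w hw
      have : 0 < ε / s ^ 2 := by positivity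
      linarith)
  have h1 : -(ε / s ^ 2) * s ^ 2 = -ε := by field_simp
  have h2 : 0 ≤ ε / s ^ 2 * ‖x - z‖ ^ 2 := by positivity
  have := hM y hy
  rw [h1] at h
  linarith

/-- The **Ahlfors–Schwarz lemma** on a disk. -/
theorem exp_mul_le_of_laplacian_eq {Ω : Set ℂ} (hΩ : IsOpen Ω) {u : ℂ → ℝ}
    (hu : ContDiffOn ℝ 2 u Ω) (heq : ∀ z ∈ Ω, Δ u z = Real.exp (2 * u z)) {c x : ℂ} {R : ℝ}
    (hR : ball c R ⊆ Ω) (hx : x ∈ ball c R) :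
    Real.exp (u x) * (R ^ 2 - ‖x - c‖ ^ 2) ≤ 2 * R := by
  have hu' : ∀ z ∈ Ω, ContDiffAt ℝ 2 u z := fun z hz => hu.contDiffAt (hΩ.mem_nhds hz)
  have main : ∀ S, ‖x - c‖ < S → S < R → Real.exp (u x) * (S ^ 2 - ‖x - c‖ ^ 2) ≤ 2 * S := by
    intro S hxS hSR
    have hS : 0 < S := (norm_nonneg _).trans_lt hxS
    have hsub : closedBall c S ⊆ Ω := (closedBall_subset_ball hSR).trans hR
    have hxS' : x ∈ closedBall c S := mem_closedBall_iff_norm.2 hxS.le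
    obtain ⟨y, hy, hmax⟩ := (isCompact_closedBall c S).exists_isMaxOn
      (f := fun y => Real.exp (u y) * (S ^ 2 - ‖y - c‖ ^ 2)) ⟨x, hxS'⟩
      ((Real.continuous_exp.comp_continuousOn (hu.continuousOn.mono hsub)).mul (by fun_prop))
    have hxy := hmax hxS'
    simp only [Set.mem_ofPred_eq] at hxy
    refine hxy.trans ?_
    have hpos : 0 < Real.exp (u x) * (S ^ 2 - ‖x - c‖ ^ 2) := by
      have : 0 < S ^ 2 - ‖x - c‖ ^ 2 := by nlinarith [norm_nonneg (x - c)]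
      positivity
    have hypos : 0 < S ^ 2 - ‖y - c‖ ^ 2 :=
      pos_of_mul_pos_right (hpos.trans_le hxy) (Real.exp_pos _).le
    have hyb : y ∈ ball c S := by
      rw [mem_ball_iff_norm]; nlinarith [norm_nonneg (y - c)]
    have hne : ‖y - c‖ ^ 2 - S ^ 2 ≠ 0 := by linarith
    have hlog : IsLocalMax (u + fun y : ℂ => Real.log (‖y - c‖ ^ 2 - S ^ 2)) y := by
      filter_upwards [isOpen_ball.mem_nhds hyb] with w hw
      have hwpos : 0 < S ^ 2 - ‖w - c‖ ^ 2 := by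
        rw [mem_ball_iff_norm] at hw; nlinarith [norm_nonneg (w - c)]
      have hwy := hmax (ball_subset_closedBall hw)
      simp only [Set.mem_ofPred_eq] at hwy
      have := Real.log_le_log (by positivity) hwy
      rw [Real.log_mul (Real.exp_pos _).ne' hwpos.ne', Real.log_mul (Real.exp_pos _).ne' hypos.ne',
        Real.log_exp, Real.log_exp] at this
      rw [Pi.add_apply, Pi.add_apply, ← neg_sub (S ^ 2), Real.log_neg_eq_log,
        ← neg_sub (S ^ 2), Real.log_neg_eq_log]
      exact this
    have hyΩ := hsub hy
    have h0 := hlog.laplacian_nonpos ((hu' y hyΩ).add (contDiffAt_log_norm_sub_sq hne))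
    rw [(hu' y hyΩ).laplacian_add (contDiffAt_log_norm_sub_sq hne), heq y hyΩ,
      laplacian_log_norm_sub_sq hne, two_mul, Real.exp_add, neg_div] at h0
    have h1 : Real.exp (u y) * Real.exp (u y) ≤ (4 * S ^ 2) / (‖y - c‖ ^ 2 - S ^ 2) ^ 2 := by
      linarith
    rw [le_div_iff₀ (by positivity)] at h1
    refine abs_le_of_sq_le_sq' ?_ (by positivity) |>.2
    nlinarith
  have hxR : ‖x - c‖ < R := mem_ball_iff_norm.1 hx
  have h1 : ContinuousWithinAt (fun S => Real.exp (u x) * (S ^ 2 - ‖x - c‖ ^ 2)) (Iio R) R := by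
    fun_prop
  have h2 : ContinuousWithinAt (fun S : ℝ => 2 * S) (Iio R) R := by fun_prop
  refine le_of_tendsto_of_tendsto h1 h2 ?_
  filter_upwards [Ioo_mem_nhdsLT hxR] with S hS using main S hS.1 hS.2

theorem exists_differentiable_re_near_on_sphere {f : ℂ → ℝ} {c : ℂ} {R : ℝ} (hR : 0 < R)
    (hf : ContinuousOn f (sphere c R)) {ε : ℝ} (hε : 0 < ε) :
    ∃ F : ℂ → ℂ, Differentiable ℂ F ∧ ∀ x ∈ sphere c R, |(F x).re - f x| ≤ ε := by
  set e : AddCircle (2 * Real.pi) → ℂ := fun θ => c + R * (θ.toCircle : ℂ) with he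
  have he_sphere : ∀ θ, e θ ∈ sphere c R := fun θ => by
    rw [mem_sphere_iff_norm]
    simp [he, abs_of_pos hR, Circle.norm_coe]
  have he_cont : Continuous e := by
    have := AddCircle.continuous_toCircle (T := 2 * Real.pi)
    fun_prop
  have hg : Continuous fun θ => (f (e θ) : ℂ) :=
    Complex.continuous_ofReal.comp (hf.comp_continuous he_cont he_sphere)
  let g : C(AddCircle (2 * Real.pi), ℂ) := ⟨_, hg⟩
  have : Fact (0 < 2 * Real.pi) := ⟨Real.two_pi_pos⟩
  have hgmem : g ∈ closure (Submodule.span ℂ (range (@fourier (2 * Real.pi))) :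
      Set C(AddCircle (2 * Real.pi), ℂ)) := by
    rw [← Submodule.topologicalClosure_coe, span_fourier_closure_eq_top]; trivial
  obtain ⟨p, hp, hgp⟩ := Metric.mem_closure_iff.1 hgmem ε hε
  have key : ∀ a : ℂ, ∃ F : ℂ → ℂ, Differentiable ℂ F ∧ ∀ θ, (F (e θ)).re = (a * p θ).re := by
    refine Submodule.span_induction (p := fun p _ => ∀ a : ℂ, ∃ F : ℂ → ℂ,
      Differentiable ℂ F ∧ ∀ θ, (F (e θ)).re = (a * p θ).re) ?_ ?_ ?_ ?_ hp
    · rintro _ ⟨n, rfl⟩ a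
      have he' : ∀ θ, (e θ - c) / R = (θ.toCircle : ℂ) := fun θ => by
        have : (R : ℂ) ≠ 0 := by exact_mod_cast hR.ne'
        simp only [he]; field_simp; ring
      obtain ⟨m, rfl | rfl⟩ := n.eq_nat_or_neg
      · refine ⟨fun z => a * ((z - c) / R) ^ m, by fun_prop, fun θ => ?_⟩
        simp only [he', fourier_apply, AddCircle.toCircle_zsmul, zpow_natCast, Circle.coe_pow]
      · refine ⟨fun z => (starRingEnd ℂ a) * ((z - c) / R) ^ m, by fun_prop, fun θ => ?_⟩
        simp only [he']
        rw [fourier_neg, ← Complex.conj_re (a * _), map_mul, Complex.conj_conj]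
        simp only [fourier_apply, AddCircle.toCircle_zsmul, zpow_natCast, Circle.coe_pow]
    · exact fun a => ⟨0, differentiable_const _, fun θ => by simp⟩
    · intro p q _ _ hp hq a
      obtain ⟨F, hF, hF'⟩ := hp a
      obtain ⟨G, hG, hG'⟩ := hq a
      exact ⟨F + G, hF.add hG, fun θ => by simp [hF', hG', mul_add]⟩
    · intro b p _ hp a
      obtain ⟨F, hF, hF'⟩ := hp (a * b)
      exact ⟨F, hF, fun θ => by simp [hF', mul_assoc]⟩
  obtain ⟨F, hF, hFp⟩ := key 1
  refine ⟨F, hF, fun x hx => ?_⟩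
  obtain ⟨t, ht⟩ : ∃ t : ℝ, circleMap c R t = x := by
    have : x ∈ range (circleMap c R) := by rwa [range_circleMap, abs_of_pos hR]
    exact this
  have hex : e (t : AddCircle (2 * Real.pi)) = x := by
    rw [← ht, circleMap, he]
    simp only [AddCircle.toCircle_apply_mk, Circle.coe_exp]
    rw [div_self Real.two_pi_pos.ne', one_mul]
  have h1 := (ContinuousMap.dist_apply_le_dist (f := g) (g := p) (t : AddCircle (2 * Real.pi)))
  rw [← hex, hFp, one_mul]
  have h2 : |(p (t : AddCircle (2 * Real.pi)) - g t).re| ≤ ε := by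
    refine (Complex.abs_re_le_norm _).trans ?_
    rw [← dist_eq_norm, dist_comm]
    exact h1.trans hgp.le
  simpa [g] using h2

theorem re_harnack {F : ℂ → ℂ} (hF : Differentiable ℂ F) {c w : ℂ} {R : ℝ}
    (h0 : ∀ x ∈ sphere c R, 0 ≤ (F x).re) (hw : w ∈ ball c R) :
    (R - ‖w - c‖) / (R + ‖w - c‖) * (F c).re ≤ (F w).re := by
  have hR : 0 < R := pos_of_mem_ball hw
  have hharm : InnerProductSpace.HarmonicOnNhd (fun z => (F z).re) (closedBall c R) :=
    fun x _ => (hF.analyticAt x).harmonicAt_re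
  have h1 := hharm.circleAverage_re_herglotzRieszKernel_smul hw
  have h2 := hharm.circleAverage_re_herglotzRieszKernel_smul (mem_ball_self hR)
  have hcont : ContinuousOn (fun z => (F z).re) (sphere c |R|) :=
    (Complex.continuous_re.comp hF.continuous).continuousOn
  have h3 : Real.circleAverage (fun z => (F z).re) c R = (F c).re := by
    rw [← h2]
    refine Real.circleAverage_congr_sphere fun z hz => ?_
    rw [abs_of_pos hR] at hz
    have : z - c ≠ 0 := by
      rw [← norm_ne_zero_iff, mem_sphere_iff_norm.1 hz]; exact hR.ne'
    simp [herglotzRieszKernel_def, this]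
  rw [← h3, ← smul_eq_mul, ← Real.circleAverage_fun_smul, ← h1]
  have habs : |R| = R := abs_of_pos hR
  have hne : ∀ z ∈ sphere c |R|, ‖z - c‖ = R := fun z hz => by
    rwa [habs, mem_sphere_iff_norm] at hz
  refine Real.circleAverage_mono ?_ ?_ ?_
  · exact ((continuousOn_const (c := (R - ‖w - c‖) / (R + ‖w - c‖))).smul hcont).circleIntegrable'
  · refine ContinuousOn.circleIntegrable' ?_
    refine (Complex.continuous_re.comp_continuousOn ?_).smul hcont
    exact continuousOn_herglotzRieszKernel_sphere hw
  · intro z hz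
    rw [habs] at hz
    exact mul_le_mul_of_nonneg_right (le_re_herglotzRieszKernel hz hw) (h0 z hz)

theorem harnack_of_laplacian_bounds {h : ℂ → ℝ} {c w : ℂ} {R K : ℝ} (hR : 0 < R)
    (hc : ContinuousOn h (closedBall c R)) (hh : ∀ x ∈ ball c R, ContDiffAt ℝ 2 h x)
    (h0 : ∀ x ∈ sphere c R, 0 ≤ h x) (hΔ : ∀ x ∈ ball c R, Δ h x ∈ Icc (-K) 0)
    (hw : ‖w - c‖ ≤ R / 2) (hw0 : 0 ≤ h w) : (h c - K * R ^ 2 / 4) / 3 ≤ h w := by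
  rcases le_or_gt (h c - K * R ^ 2 / 4) 0 with hneg | hpos
  · linarith
  refine le_of_forall_pos_le_add fun ε hε => ?_
  obtain ⟨F, hF, hFε⟩ := exists_differentiable_re_near_on_sphere hR
    (hc.mono sphere_subset_closedBall) (half_pos hε)
  have hharm : ∀ x, InnerProductSpace.HarmonicAt (fun z => (F z).re) x := fun x =>
    (hF.analyticAt x).harmonicAt_re
  have hHc : Continuous fun z => (F z).re := Complex.continuous_re.comp hF.continuous
  have hHd : ∀ x, ContDiffAt ℝ 2 (fun z => (F z).re) x := fun x => (hharm x).1
  have hHΔ : ∀ x, Δ (fun z => (F z).re) x = 0 := fun x => (hharm x).2.eq_of_nhds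
  have hwb : w ∈ closedBall c R := mem_closedBall_iff_norm.2 (by linarith)
  have hlow : (F w).re - h w ≤ ε / 2 := by
    refine le_of_laplacian_nonneg (φ := (fun z => (F z).re) - h) (hHc.continuousOn.sub hc)
      (fun x hx => (hHd x).sub (hh x hx)) (fun x hx => ?_) (fun y hy => ?_) hwb
    · rw [(hHd x).laplacian_sub (hh x hx), hHΔ x]
      linarith [(hΔ x hx).2]
    · exact (abs_le.1 (hFε y hy)).2
  have hup : h c - (F c).re ≤ ε / 2 + K * R ^ 2 / 4 := by
    have hq : ∀ x, ContDiffAt ℝ 2 ((K / 4) • fun x : ℂ => ‖x - c‖ ^ 2) x := fun x =>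
      (contDiff_norm_sub_sq c).contDiffAt.const_smul (K / 4)
    have hsub : ∀ x ∈ ball c R, ContDiffAt ℝ 2 (h - fun z => (F z).re) x := fun x hx =>
      (hh x hx).sub (hHd x)
    have := le_of_laplacian_nonneg (z := c) (s := R) (x := c) (M := ε / 2 + K * R ^ 2 / 4)
      (φ := h - (fun z => (F z).re) + (K / 4) • fun x : ℂ => ‖x - c‖ ^ 2)
      ((hc.sub hHc.continuousOn).add
        ((contDiff_norm_sub_sq c).continuous.continuousOn.const_smul (K / 4)))
      (fun x hx => (hsub x hx).add (hq x)) (fun x hx => ?_) (fun y hy => ?_)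
      (mem_closedBall_self hR.le)
    · simpa using this
    · rw [(hsub x hx).laplacian_add (hq x), (hh x hx).laplacian_sub (hHd x), hHΔ x,
        InnerProductSpace.laplacian_smul (K / 4) (contDiff_norm_sub_sq c).contDiffAt,
        laplacian_norm_sub_sq, smul_eq_mul]
      linarith [(hΔ x hx).1]
    · have := (abs_le.1 (hFε y hy)).1
      simp only [Pi.add_apply, Pi.sub_apply, Pi.smul_apply, smul_eq_mul, mem_sphere_iff_norm.1 hy]
      linarith
  have hhar := re_harnack (F := fun z => F z + (ε / 2 : ℝ)) (by fun_prop) (c := c) (w := w) (R := R)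
    (fun x hx => by
      have := (abs_le.1 (hFε x hx)).1
      have := h0 x hx
      simp only [Complex.add_re, Complex.ofReal_re]
      linarith) (mem_ball_iff_norm.2 (by linarith))
  simp only [Complex.add_re, Complex.ofReal_re] at hhar
  have hratio : 1 / 3 ≤ (R - ‖w - c‖) / (R + ‖w - c‖) := by
    rw [div_le_div_iff₀ (by norm_num) (by positivity)]; linarith
  have := mul_le_mul_of_nonneg_right hratio (show 0 ≤ (F c).re + ε / 2 by linarith)
  linarith

/-- The polygonal path through the points `z 0, z 1, …`, parametrized by `[0, ∞)`. -/
noncomputable def polygonalPath (z : ℕ → ℂ) (s : ℝ) : ℂ :=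
  z ⌊s⌋₊ + (s - ⌊s⌋₊) • (z (⌊s⌋₊ + 1) - z ⌊s⌋₊)

theorem polygonalPath_eq (z : ℕ → ℂ) {n : ℕ} {s : ℝ} (hs : s ∈ Icc (n : ℝ) (n + 1)) :
    polygonalPath z s = z n + (s - n) • (z (n + 1) - z n) := by
  rcases hs.2.eq_or_lt with h | h
  · have : ⌊s⌋₊ = n + 1 := by rw [h]; exact_mod_cast Nat.floor_natCast (R := ℝ) (n + 1)
    rw [polygonalPath, this, h]
    simp
  · have : ⌊s⌋₊ = n := (Nat.floor_eq_iff (n.cast_nonneg.trans hs.1)).2 ⟨hs.1, h⟩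
    rw [polygonalPath, this]

theorem polygonalPath_mem_segment (z : ℕ → ℂ) {n : ℕ} {s : ℝ} (hs : s ∈ Icc (n : ℝ) (n + 1)) :
    polygonalPath z s ∈ segment ℝ (z n) (z (n + 1)) := by
  rw [polygonalPath_eq z hs, segment_eq_image']
  exact ⟨s - n, ⟨sub_nonneg.2 hs.1, by linarith [hs.2]⟩, rfl⟩

theorem continuousOn_polygonalPath (z : ℕ → ℂ) : ContinuousOn (polygonalPath z) (Ici 0) := by
  have h : ∀ n : ℕ, ContinuousOn (polygonalPath z) (Icc 0 n) := by
    intro n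
    induction n with
    | zero => simp
    | succ n ih =>
      have h1 : ContinuousOn (polygonalPath z) (Icc (n : ℝ) (n + 1)) :=
        ContinuousOn.congr (f := fun s : ℝ => z n + (s - n) • (z (n + 1) - z n)) (by fun_prop)
          fun s hs => polygonalPath_eq z hs
      rw [← Icc_union_Icc_eq_Icc (b := (n : ℝ)) n.cast_nonneg (by push_cast; linarith)]
      push_cast
      exact ih.union_of_isClosed h1 isClosed_Icc isClosed_Icc
  intro s hs
  obtain ⟨n, hn⟩ := exists_nat_gt s
  exact ((h n) s ⟨hs, hn.le⟩).mono_of_mem_nhdsWithin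
    (mem_nhdsWithin.2 ⟨Iio n, isOpen_Iio, hn, fun x hx => ⟨hx.2, le_of_lt hx.1⟩⟩)

theorem le_div_one_sub_iff {a t : ℝ} (ha : 0 ≤ a) (ht : t < 1) :
    a ≤ t / (1 - t) ↔ a / (a + 1) ≤ t := by
  rw [le_div_iff₀ (by linarith), div_le_iff₀ (by linarith)]
  constructor <;> intro h <;> linarith

theorem div_one_sub_le_iff {a t : ℝ} (ha : 0 ≤ a) (ht : t < 1) :
    t / (1 - t) ≤ a ↔ t ≤ a / (a + 1) := by
  rw [div_le_iff₀ (by linarith), le_div_iff₀ (by linarith)]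
  constructor <;> intro h <;> linarith

theorem div_one_sub_mem_Icc {n : ℕ} {t : ℝ} (ht : t < 1)
    (h : t ∈ Icc ((n : ℝ) / (n + 1)) ((n + 1 : ℝ) / (n + 1 + 1))) :
    t / (1 - t) ∈ Icc (n : ℝ) (n + 1) :=
  ⟨(le_div_one_sub_iff n.cast_nonneg ht).2 h.1, (div_one_sub_le_iff (by positivity) ht).2 h.2⟩

theorem exists_mem_Ico_div_add_one {t : ℝ} (ht0 : 0 ≤ t) (ht : t < 1) :
    ∃ n : ℕ, t ∈ Ico ((n : ℝ) / (n + 1)) ((n + 1 : ℝ) / (n + 1 + 1)) := by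
  have h0 : 0 ≤ t / (1 - t) := div_nonneg ht0 (by linarith)
  refine ⟨⌊t / (1 - t)⌋₊, (le_div_one_sub_iff (Nat.cast_nonneg _) ht).1 (Nat.floor_le h0), ?_⟩
  rw [← not_le, ← le_div_one_sub_iff (by positivity) ht, not_le]
  exact Nat.lt_floor_add_one _

theorem div_add_one_mono {a b : ℝ} (ha : 0 ≤ a) (hab : a ≤ b) : a / (a + 1) ≤ b / (b + 1) := by
  rw [div_le_div_iff₀ (by linarith) (by linarith)]; linarith

theorem ConformallyComplete.false_of_summable_polygon {u : ℂ → ℝ} {Ω : Set ℂ}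
    (hcomp : ConformallyComplete u Ω) {z : ℕ → ℂ} {q C : ℝ} (hq0 : 0 ≤ q) (hq1 : q < 1)
    (hΩ : ∀ n, segment ℝ (z n) (z (n + 1)) ⊆ Ω)
    (hlen : ∀ n, ∀ x ∈ segment ℝ (z n) (z (n + 1)),
      Real.exp (u x) * ‖z (n + 1) - z n‖ ≤ C * q ^ n)
    (hK : ∀ K ⊆ Ω, IsCompact K → ∃ N, ∀ n ≥ N, Disjoint (segment ℝ (z n) (z (n + 1))) K) :
    False := by
  set γ : ℝ → ℂ := fun t => polygonalPath z (t / (1 - t)) with hγ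
  have hform : ∀ (n : ℕ) (t : ℝ), t < 1 →
      t ∈ Icc ((n : ℝ) / (n + 1)) ((n + 1 : ℝ) / (n + 1 + 1)) →
      γ t = z n + (t / (1 - t) - n) • (z (n + 1) - z n) := fun n t ht h =>
    polygonalPath_eq z (div_one_sub_mem_Icc ht h)
  have hseg : ∀ (n : ℕ) (t : ℝ), t < 1 →
      t ∈ Icc ((n : ℝ) / (n + 1)) ((n + 1 : ℝ) / (n + 1 + 1)) →
      γ t ∈ segment ℝ (z n) (z (n + 1)) := fun n t ht h =>
    polygonalPath_mem_segment z (div_one_sub_mem_Icc ht h)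
  have hinf := hcomp γ ?_ ?_ ?_ ?_
  · refine hinf.not_lt ?_
    have hC : ∀ n : ℕ, 0 ≤ C * q ^ n := fun n =>
      le_trans (by positivity) (hlen n (z n) (left_mem_segment ℝ _ _))
    have hbound : ∀ n : ℕ,
        ∫⁻ t in Ico ((n : ℝ) / (n + 1)) ((n + 1 : ℝ) / (n + 1 + 1)),
          ENNReal.ofReal (Real.exp (u (γ t)) * ‖deriv γ t‖)
          ≤ ENNReal.ofReal ((n + 2) ^ 2 * (C * q ^ n)) := by
      intro n
      have hlt1 : (n + 1 : ℝ) / (n + 1 + 1) < 1 := by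
        rw [div_lt_one (by positivity)]; linarith
      rw [← MeasureTheory.setLIntegral_congr MeasureTheory.Ioo_ae_eq_Ico]
      calc _ ≤ ∫⁻ t in Ioo ((n : ℝ) / (n + 1)) ((n + 1 : ℝ) / (n + 1 + 1)),
              ENNReal.ofReal ((n + 2) ^ 2 * (C * q ^ n)) := by
            refine MeasureTheory.setLIntegral_mono measurable_const fun t ht => ?_
            refine ENNReal.ofReal_le_ofReal ?_
            have ht1 : t < 1 := ht.2.trans hlt1
            have hev : γ =ᶠ[𝓝 t] fun t => z n + (t / (1 - t) - n) • (z (n + 1) - z n) := by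
              filter_upwards [Ioo_mem_nhds ht.1 ht.2] with x hx
              exact hform n x (hx.2.trans hlt1) (Ioo_subset_Icc_self hx)
            have hd0 : HasDerivAt (fun t : ℝ => t / (1 - t)) (1 / (1 - t) ^ 2) t := by
              have := (hasDerivAt_id t).fun_div ((hasDerivAt_id t).const_sub 1)
                (by simpa using (sub_pos.2 ht1).ne')
              simpa using this
            have hd : HasDerivAt (fun t : ℝ => z n + (t / (1 - t) - n) • (z (n + 1) - z n))
                ((1 / (1 - t) ^ 2) • (z (n + 1) - z n)) t :=
              ((hd0.sub_const _).smul_const _).const_add _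
            rw [hev.deriv_eq, hd.deriv, norm_smul, Real.norm_of_nonneg (by positivity)]
            have h1 : 1 / (1 - t) ^ 2 ≤ (n + 2 : ℝ) ^ 2 := by
              have h2 : 1 / (n + 2 : ℝ) ≤ 1 - t := by
                have := ht.2
                rw [lt_div_iff₀ (by positivity)] at this
                rw [div_le_iff₀ (by positivity)]; linarith
              rw [div_le_iff₀ (by have := sub_pos.2 ht1; positivity), ← mul_pow]
              refine one_le_pow₀ ?_
              rw [div_le_iff₀ (by positivity)] at h2; linarith
            calc _ = 1 / (1 - t) ^ 2 * (Real.exp (u (γ t)) * ‖z (n + 1) - z n‖) := by ring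
              _ ≤ _ := mul_le_mul h1 (hlen n _ (hseg n t ht1 (Ioo_subset_Icc_self ht)))
                (by positivity) (by positivity)
        _ ≤ _ := by
            rw [MeasureTheory.setLIntegral_const, Real.volume_Ioo]
            refine mul_le_of_le_one_right' ?_
            rw [ENNReal.ofReal_le_one]
            have : 0 ≤ (n : ℝ) / (n + 1) := by positivity
            linarith
    have hcover : Ioo (0 : ℝ) 1 ⊆
        ⋃ n : ℕ, Ico ((n : ℝ) / (n + 1)) ((n + 1 : ℝ) / (n + 1 + 1)) := fun t ht =>
      mem_iUnion.2 (exists_mem_Ico_div_add_one ht.1.le ht.2)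
    have hsum : Summable fun n : ℕ => ((n : ℝ) + 2) ^ 2 * (C * q ^ n) := by
      have hq : ‖q‖ < 1 := by rwa [Real.norm_of_nonneg hq0]
      have h0 := summable_pow_mul_geometric_of_norm_lt_one 0 hq
      have h1 := summable_pow_mul_geometric_of_norm_lt_one 1 hq
      have h2 := summable_pow_mul_geometric_of_norm_lt_one 2 hq
      refine (((h2.add (h1.mul_left 4)).add (h0.mul_left 4)).mul_left C).congr fun n => ?_
      ring
    calc _ ≤ _ := MeasureTheory.lintegral_mono_set hcover
      _ ≤ _ := MeasureTheory.lintegral_iUnion_le _ _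
      _ ≤ _ := ENNReal.tsum_le_tsum hbound
      _ < ⊤ := hsum.tsum_ofReal_lt_top
  · refine (continuousOn_polygonalPath z).comp
      (continuousOn_id.div (continuousOn_const.sub continuousOn_id) fun t ht => ?_) fun t ht => ?_
    · exact (sub_pos.2 ht.2).ne'
    · exact div_nonneg ht.1 (sub_nonneg.2 ht.2.le)
  · intro t ht
    obtain ⟨n, hn⟩ := exists_mem_Ico_div_add_one ht.1 ht.2
    exact hΩ n (hseg n t ht.2 (Ico_subset_Icc_self hn))
  · intro s hs
    refine ⟨⌈s / (1 - s)⌉₊, fun i => min ((i : ℕ) / ((i : ℕ) + 1)) s, ?_, ?_, ?_, ?_⟩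
    · intro i j hij
      exact min_le_min_right _ (div_add_one_mono (Nat.cast_nonneg _) (by exact_mod_cast hij))
    · simpa using hs.1
    · refine min_eq_right ?_
      rw [Fin.val_last, ← div_one_sub_le_iff (Nat.cast_nonneg _) hs.2]
      exact Nat.le_ceil _
    · intro i
      refine ContDiffOn.congr (f := fun t : ℝ =>
        z i + (t / (1 - t) - (i : ℕ)) • (z (i + 1) - z i)) ?_ fun t ht => ?_
      · intro t ht
        have h1 : 1 - t ≠ 0 :=
          (sub_pos.2 ((ht.2.trans (min_le_right _ _)).trans_lt hs.2)).ne'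
        have h2 : ContDiffAt ℝ 1 (fun t : ℝ => t / (1 - t)) t :=
          ContDiffAt.div contDiffAt_id (contDiffAt_const.sub contDiffAt_id) h1
        fun_prop
      · have ht1 : t ≤ s := ht.2.trans (min_le_right _ _)
        refine hform i t (ht1.trans_lt hs.2) ⟨?_, ?_⟩
        · refine (le_min le_rfl ?_).trans ht.1
          exact (le_div_one_sub_iff (Nat.cast_nonneg _) hs.2).1 (Nat.lt_ceil.1 i.isLt).le
        · have := ht.2.trans (min_le_left _ _)
          simpa using this
  · intro K hKc hKΩ
    obtain ⟨N, hN⟩ := hK K hKΩ hKc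
    refine ⟨N / (N + 1), by positivity, by rw [div_lt_one (by positivity)]; linarith,
      fun t ht ht1 htK => ?_⟩
    have ht0 : 0 ≤ t := le_trans (by positivity) ht
    obtain ⟨n, hn⟩ := exists_mem_Ico_div_add_one ht0 ht1
    have hNn : N ≤ n := by
      by_contra! h
      have h' : (n + 1 : ℝ) ≤ N := by exact_mod_cast h
      exact absurd (div_add_one_mono (by positivity) h') (not_le.2 (ht.trans_lt hn.2))
    exact disjoint_left.1 (hN n hNn) (hseg n t ht1 (Ico_subset_Icc_self hn)) htK

theorem Metric.ball_infDist_frontier_subset {Ω : Set ℂ} {p : ℂ} (hp : p ∈ Ω) :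
    ball p (infDist p (frontier Ω)) ⊆ Ω := by
  intro x hx
  by_contra hxΩ
  have hne : 0 < infDist p (frontier Ω) := pos_of_mem_ball hx
  have hnf : ∀ y ∈ ball p (infDist p (frontier Ω)), y ∉ frontier Ω := fun y hy hyf =>
    (infDist_le_dist_of_mem hyf).not_gt (mem_ball'.1 hy)
  have hmem : ∀ y ∈ ball p (infDist p (frontier Ω)), y ∈ interior Ω ∪ (closure Ω)ᶜ := by
    intro y hy
    by_contra h
    rw [mem_union, not_or, notMem_compl_iff] at h
    exact hnf y hy ⟨h.2, h.1⟩
  have hpi : p ∈ interior Ω :=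
    (hmem p (mem_ball_self hne)).resolve_right fun h => h (subset_closure hp)
  have hxe : x ∈ (closure Ω)ᶜ :=
    (hmem x hx).resolve_left fun h => hxΩ (interior_subset h)
  obtain ⟨y, -, hy1, hy2⟩ := (convex_ball p (infDist p (frontier Ω))).isPreconnected
    (interior Ω) (closure Ω)ᶜ isOpen_interior isClosed_closure.isOpen_compl hmem
    ⟨p, mem_ball_self hne, hpi⟩ ⟨x, hx, hxe⟩
  exact hy2 (subset_closure (interior_subset hy1))

theorem add_infDist_frontier_le_dist {Ω : Set ℂ} {p c : ℂ} {r : ℝ} (hr : 0 < r) (hp : p ∈ Ω)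
    (hpos : 0 < infDist p (frontier Ω)) (hc : closedBall c r ⊆ Ωᶜ) :
    r + infDist p (frontier Ω) ≤ dist p c := by
  rw [add_comm, ← disjoint_ball_ball_iff hpos hr]
  exact (disjoint_compl_right.mono_left (ball_infDist_frontier_subset hp)).mono_right
    (ball_subset_closedBall.trans hc)

theorem ball_subset_of_exterior_disks {Ω : Set ℂ} {r : ℝ} (hr : 0 < r)
    (hext : ∀ p ∈ frontier Ω, ∃ c, dist p c = r ∧ closedBall c r ⊆ Ωᶜ) {c : ℂ}
    (hc : closedBall c r ⊆ closure Ω) : ball c r ⊆ Ω := by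
  intro y hy
  by_contra hyΩ
  have hyf : y ∈ frontier Ω :=
    ⟨hc (ball_subset_closedBall hy), fun h => hyΩ (interior_subset h)⟩
  obtain ⟨c', hyc', hc'⟩ := hext y hyf
  have hdisj : Disjoint (ball c r) (ball c' r) := by
    refine Disjoint.mono_left (ball_subset_closedBall.trans hc)
      (Disjoint.closure_left ?_ isOpen_ball)
    exact disjoint_compl_right.mono_right (ball_subset_closedBall.trans hc')
  rw [disjoint_ball_ball_iff hr hr] at hdisj
  have := dist_triangle c y c'
  rw [mem_ball'] at hy
  linarith

theorem norm_sub_eq_of_tangent_disks {p q cin cout : ℂ} {r d : ℝ} (hpq : dist p q = d)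
    (hin : dist q cin = r) (hout : dist q cout = r) (hp : r + d ≤ dist p cout)
    (hcc : r + r ≤ dist cin cout) : dist p cin = |d - r| ∧ dist p cout = r + d := by
  rw [dist_eq_norm] at *
  rw [dist_eq_norm]
  have ha : p - cout = (p - q) + (q - cout) := by ring
  have he : cin - cout = (cin - q) + (q - cout) := by ring
  have hin' : ‖cin - q‖ = r := by rw [norm_sub_rev, hin]
  have h1 : ‖(p - q) + (q - cout)‖ = ‖p - q‖ + ‖q - cout‖ :=
    le_antisymm (norm_add_le _ _) (by rw [← ha, hpq, hout]; linarith)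
  have h2 : ‖(cin - q) + (q - cout)‖ = ‖cin - q‖ + ‖q - cout‖ :=
    le_antisymm (norm_add_le _ _) (by rw [← he, hin', hout]; linarith)
  have h3 : cin - q = q - cout :=
    (sameRay_iff_norm_add.2 h2).norm_eq_iff.1 (by rw [hin', hout])
  refine ⟨?_, by rw [ha, h1, hpq, hout, add_comm]⟩
  have : p - cin = (p - q) - (q - cout) := by rw [← h3]; ring
  rw [this, (sameRay_iff_norm_add.2 h1).norm_sub, hpq, hout]

/-- With `d x = dist(x, ∂Ω)`, the defect is positive iff `d · e^u < 2r / (2r + d)`. -/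
noncomputable def boundaryDefect (Ω : Set ℂ) (r : ℝ) (u : ℂ → ℝ) (x : ℂ) : ℝ :=
  Real.log (2 * r) -
    Real.log (infDist x (frontier Ω) * (2 * r + infDist x (frontier Ω))) - u x

theorem laplacian_log_sub_log_sub {u : ℂ → ℝ} {c x : ℂ} {r : ℝ} (hr : 0 < r)
    (hx : 0 < ‖x - c‖ ^ 2 - r ^ 2) (hu : ContDiffAt ℝ 2 u x)
    (heq : Δ u x = Real.exp (2 * u x)) :
    Δ ((fun x => Real.log (2 * r) - Real.log (‖x - c‖ ^ 2 - r ^ 2)) - u) x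
      = (2 * r / (‖x - c‖ ^ 2 - r ^ 2)) ^ 2 *
        (1 - Real.exp (-(2 * (Real.log (2 * r) - Real.log (‖x - c‖ ^ 2 - r ^ 2) - u x)))) := by
  have h1 := contDiffAt_log_norm_sub_sq (R := r) hx.ne'
  have h2 : ContDiffAt ℝ 2 ((fun _ : ℂ => Real.log (2 * r)) -
      fun x => Real.log (‖x - c‖ ^ 2 - r ^ 2)) x := contDiffAt_const.sub h1
  have h3 := h2.laplacian_sub hu
  rw [(contDiffAt_const (c := Real.log (2 * r))).laplacian_sub h1,
    InnerProductSpace.laplacian_const, laplacian_log_norm_sub_sq hx.ne', heq] at h3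
  refine h3.trans ?_
  have h4 : Real.exp (-(2 * (Real.log (2 * r) - Real.log (‖x - c‖ ^ 2 - r ^ 2) - u x)))
      = ((‖x - c‖ ^ 2 - r ^ 2) / (2 * r)) ^ 2 * Real.exp (2 * u x) := by
    rw [← Real.exp_log hx, ← Real.exp_log (show 0 < 2 * r by positivity), ← Real.exp_sub,
      ← Real.exp_nat_mul, ← Real.exp_add]
    simp only [Real.log_exp]
    congr 1
    push_cast
    ring
  rw [h4, Pi.zero_apply]
  field_simp
  ring

variable {Ω : Set ℂ} {u : ℂ → ℝ} {r D : ℝ}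

theorem exists_boundaryDefect_add_le (hopen : IsOpen Ω) (hr : 0 < r)
    (hpos : ∀ z ∈ Ω, 0 < infDist z (frontier Ω)) (hD : ∀ z ∈ Ω, infDist z (frontier Ω) ≤ D)
    (hext : ∀ z ∈ Ω, ∃ c, dist z c = r + infDist z (frontier Ω) ∧ closedBall c r ⊆ Ωᶜ)
    (hu : ContDiffOn ℝ 2 u Ω) (heq : ∀ z ∈ Ω, Δ u z = Real.exp (2 * u z)) {m : ℝ} (hm : 0 < m) :
    ∃ k > 0, ∀ z ∈ Ω, m ≤ boundaryDefect Ω r u z → ∃ z' ∈ Ω,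
      dist z' z ≤ infDist z (frontier Ω) / 4 ∧
      boundaryDefect Ω r u z + k ≤ boundaryDefect Ω r u z' := by
  set E : ℝ := 1 - Real.exp (-(2 * m)) with hE
  have hEpos : 0 < E := by rw [hE, sub_pos, Real.exp_lt_one_iff]; linarith
  rcases Ω.eq_empty_or_nonempty with rfl | ⟨w, hw⟩
  · exact ⟨1, one_pos, by simp⟩
  have hDpos : 0 < D := (hpos w hw).trans_le (hD w hw)
  set a : ℝ := 2 * r / (5 / 4 * (2 * r + 5 / 4 * D)) with ha
  have hapos : 0 < a := by positivity
  refine ⟨a ^ 2 * E / 128, by positivity, fun z hz hmz => ?_⟩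
  set d := infDist z (frontier Ω) with hd
  have hdpos : 0 < d := hpos z hz
  obtain ⟨c, hzc, hc⟩ := hext z hz
  have hsub : closedBall z (d / 4) ⊆ Ω :=
    (closedBall_subset_ball (by linarith)).trans (ball_infDist_frontier_subset hz)
  have hQ : ∀ x ∈ Ω, infDist x (frontier Ω) * (2 * r + infDist x (frontier Ω))
      ≤ ‖x - c‖ ^ 2 - r ^ 2 := by
    intro x hx
    have h1 := add_infDist_frontier_le_dist hr hx (hpos x hx) hc
    rw [dist_eq_norm] at h1
    have h2 := hpos x hx
    nlinarith
  have hQpos : ∀ x ∈ Ω, 0 < ‖x - c‖ ^ 2 - r ^ 2 := fun x hx =>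
    lt_of_lt_of_le (by have := hpos x hx; positivity) (hQ x hx)
  have hu' : ∀ x ∈ Ω, ContDiffAt ℝ 2 u x := fun x hx => hu.contDiffAt (hopen.mem_nhds hx)
  set φ : ℂ → ℝ := (fun x => Real.log (2 * r) - Real.log (‖x - c‖ ^ 2 - r ^ 2)) - u with hφ
  have hφd : ∀ x ∈ Ω, ContDiffAt ℝ 2 φ x := fun x hx =>
    (contDiffAt_const.sub (contDiffAt_log_norm_sub_sq (hQpos x hx).ne')).sub (hu' x hx)
  have hφle : ∀ x ∈ Ω, φ x ≤ boundaryDefect Ω r u x := by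
    intro x hx
    have h := Real.log_le_log (by have := hpos x hx; positivity) (hQ x hx)
    simp only [hφ, Pi.sub_apply, boundaryDefect]
    linarith
  have hφz : φ z = boundaryDefect Ω r u z := by
    simp only [hφ, Pi.sub_apply, boundaryDefect]
    rw [← dist_eq_norm, hzc]
    ring_nf
  have hΔ : ∀ x ∈ ball z (d / 4),
      φ z - a ^ 2 * E / (8 * d ^ 2) * ‖z - z‖ ^ 2 ≤ φ x - a ^ 2 * E / (8 * d ^ 2) * ‖x - z‖ ^ 2 →
      4 * (a ^ 2 * E / (8 * d ^ 2)) < Δ φ x := by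
    intro x hx hle
    have hxΩ := hsub (ball_subset_closedBall hx)
    have hφx : m ≤ φ x := by
      have : 0 ≤ a ^ 2 * E / (8 * d ^ 2) * ‖x - z‖ ^ 2 := by positivity
      rw [sub_self, norm_zero, hφz] at hle
      linarith
    rw [laplacian_log_sub_log_sub hr (hQpos x hxΩ) (hu' x hxΩ) (heq x hxΩ)]
    have h1 : E ≤ 1 - Real.exp (-(2 * φ x)) := by
      rw [hE]; gcongr
    have h2 : a / d ≤ 2 * r / (‖x - c‖ ^ 2 - r ^ 2) := by
      rw [ha, div_div]
      refine div_le_div_of_nonneg_left (by positivity) (hQpos x hxΩ) ?_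
      have h3 : ‖x - c‖ ≤ r + 5 / 4 * d := by
        have := dist_triangle x z c
        rw [mem_ball] at hx
        rw [← dist_eq_norm]; linarith
      have h4 : ‖x - c‖ ^ 2 ≤ (r + 5 / 4 * d) ^ 2 := by gcongr
      have h5 : d * d ≤ d * D := by have := hD z hz; gcongr
      nlinarith
    calc 4 * (a ^ 2 * E / (8 * d ^ 2)) = (a / d) ^ 2 * E / 2 := by field_simp; norm_num
      _ < (a / d) ^ 2 * E := by
        have : 0 < (a / d) ^ 2 * E := by positivity
        linarith
      _ ≤ _ := by
        have h6 : (a / d) ^ 2 ≤ (2 * r / (‖x - c‖ ^ 2 - r ^ 2)) ^ 2 := by gcongr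
        exact mul_le_mul h6 h1 hEpos.le (by positivity)
  obtain ⟨y, hy, hyle⟩ := exists_mem_sphere_of_lt_laplacian (φ := φ) (z := z) (x₀ := z)
    (s := d / 4) (k := a ^ 2 * E / (8 * d ^ 2))
    (fun x hx => (hφd x (hsub hx)).continuousAt.continuousWithinAt)
    (fun x hx => hφd x (hsub (ball_subset_closedBall hx)))
    (mem_ball_self (by positivity)) hΔ
  refine ⟨y, hsub (sphere_subset_closedBall hy), (mem_sphere.1 hy).le, ?_⟩
  refine le_trans ?_ (hφle y (hsub (sphere_subset_closedBall hy)))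
  rw [sub_self, norm_zero, hφz] at hyle
  have : a ^ 2 * E / (8 * d ^ 2) * (d / 4) ^ 2 = a ^ 2 * E / 128 := by field_simp; norm_num
  rw [this] at hyle
  linarith

theorem exp_mul_infDist_frontier_le_two (hopen : IsOpen Ω) (hu : ContDiffOn ℝ 2 u Ω)
    (heq : ∀ z ∈ Ω, Δ u z = Real.exp (2 * u z)) {x : ℂ} (hx : x ∈ Ω)
    (hpos : 0 < infDist x (frontier Ω)) : Real.exp (u x) * infDist x (frontier Ω) ≤ 2 := by
  have := exp_mul_le_of_laplacian_eq hopen hu heq (ball_infDist_frontier_subset hx)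
    (mem_ball_self hpos)
  rw [sub_self, norm_zero] at this
  nlinarith

theorem infDist_le_add_of_mem_closedBall {s : Set ℂ} {x z : ℂ} {ρ : ℝ} (hx : x ∈ closedBall z ρ) :
    infDist x s ≤ infDist z s + ρ ∧ infDist z s ≤ infDist x s + ρ := by
  have h1 := infDist_le_infDist_add_dist (s := s) (x := x) (y := z)
  have h2 := infDist_le_infDist_add_dist (s := s) (x := z) (y := x)
  rw [dist_comm] at h2
  rw [mem_closedBall] at hx
  constructor <;> linarith

theorem exp_mul_infDist_frontier_le_of_boundaryDefect (hopen : IsOpen Ω) (hr : 0 < r)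
    (hpos : ∀ z ∈ Ω, 0 < infDist z (frontier Ω))
    (hu : ContDiffOn ℝ 2 u Ω) (heq : ∀ z ∈ Ω, Δ u z = Real.exp (2 * u z)) {z x : ℂ} (hz : z ∈ Ω)
    (hx : dist x z ≤ infDist z (frontier Ω) / 4) :
    Real.exp (u x) * (infDist z (frontier Ω) / 4)
      ≤ Real.exp (-((boundaryDefect Ω r u z - 1) / 3)) := by
  set d := infDist z (frontier Ω) with hd
  have hdpos : 0 < d := hpos z hz
  have hsub : closedBall z (d / 2) ⊆ Ω :=
    (closedBall_subset_ball (by linarith)).trans (ball_infDist_frontier_subset hz)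
  have hu' : ∀ x ∈ Ω, ContDiffAt ℝ 2 u x := fun x hx => hu.contDiffAt (hopen.mem_nhds hx)
  have hexp : ∀ y ∈ closedBall z (d / 2), Real.exp (u y) ≤ 4 / d := by
    intro y hy
    have h1 := exp_mul_infDist_frontier_le_two hopen hu heq (hsub hy) (hpos y (hsub hy))
    have h2 := (infDist_le_add_of_mem_closedBall (s := frontier Ω) hy).2
    rw [le_div_iff₀ hdpos]
    nlinarith [Real.exp_pos (u y)]
  have hnonneg : ∀ y ∈ closedBall z (d / 2), 0 ≤ Real.log (4 / d) - u y := by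
    intro y hy
    have := Real.log_le_log (Real.exp_pos _) (hexp y hy)
    rw [Real.log_exp] at this
    linarith
  have hxm : x ∈ closedBall z (d / 2) := by rw [mem_closedBall]; linarith
  have hh := harnack_of_laplacian_bounds (h := (fun _ => Real.log (4 / d)) - u) (c := z) (w := x)
    (R := d / 2) (K := (4 / d) ^ 2) (by positivity)
    (continuousOn_const.sub (hu.continuousOn.mono hsub))
    (fun y hy => contDiffAt_const.sub (hu' y (hsub (ball_subset_closedBall hy))))
    (fun y hy => hnonneg y (sphere_subset_closedBall hy)) (fun y hy => ?_)
    (by rw [← dist_eq_norm]; linarith) (hnonneg x hxm)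
  · have hK : (4 / d) ^ 2 * (d / 2) ^ 2 / 4 = 1 := by field_simp; norm_num
    rw [hK] at hh
    simp only [Pi.sub_apply] at hh
    have hdef : boundaryDefect Ω r u z ≤ Real.log (4 / d) - u z := by
      rw [boundaryDefect, ← Real.log_div (by positivity) (by positivity)]
      refine sub_le_sub_right (Real.log_le_log (by positivity) ?_) _
      rw [div_le_div_iff₀ (by positivity) hdpos]
      nlinarith [mul_pos hr hdpos, mul_pos hdpos hdpos]
    have h1 : u x ≤ Real.log (4 / d) + -((boundaryDefect Ω r u z - 1) / 3) := by linarith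
    have h2 := Real.exp_le_exp.2 h1
    rw [Real.exp_add, Real.exp_log (by positivity)] at h2
    calc _ ≤ 4 / d * Real.exp (-((boundaryDefect Ω r u z - 1) / 3)) * (d / 4) := by gcongr
      _ = _ := by field_simp
  · have hyΩ := hsub (ball_subset_closedBall hy)
    have h1 := hexp y (ball_subset_closedBall hy)
    rw [contDiffAt_const.laplacian_sub (hu' y hyΩ), InnerProductSpace.laplacian_const,
      Pi.zero_apply, heq y hyΩ, two_mul, Real.exp_add]
    constructor
    · nlinarith [Real.exp_pos (u y)]
    · nlinarith [Real.exp_pos (u y)]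

theorem boundaryDefect_nonpos (hopen : IsOpen Ω) (hr : 0 < r)
    (hpos : ∀ z ∈ Ω, 0 < infDist z (frontier Ω)) (hD : ∀ z ∈ Ω, infDist z (frontier Ω) ≤ D)
    (hext : ∀ z ∈ Ω, ∃ c, dist z c = r + infDist z (frontier Ω) ∧ closedBall c r ⊆ Ωᶜ)
    (hu : ContDiffOn ℝ 2 u Ω) (heq : ∀ z ∈ Ω, Δ u z = Real.exp (2 * u z))
    (hcomp : ConformallyComplete u Ω) {z₀ : ℂ} (hz₀ : z₀ ∈ Ω) : boundaryDefect Ω r u z₀ ≤ 0 := by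
  by_contra! hm
  set w := boundaryDefect Ω r u with hw
  obtain ⟨k, hk, hstep⟩ := exists_boundaryDefect_add_le hopen hr hpos hD hext hu heq hm
  choose! f hfΩ hfd hfw using hstep
  set z : ℕ → ℂ := fun n => f^[n] z₀ with hz
  have hsucc : ∀ n, z (n + 1) = f (z n) := fun n => Function.iterate_succ_apply' f n z₀
  have hzn : ∀ n : ℕ, z n ∈ Ω ∧ w z₀ + k * n ≤ w (z n) := by
    intro n
    induction n with
    | zero => simpa [hz] using hz₀
    | succ n ih =>
      have h0 : 0 ≤ k * n := by positivity
      have h1 : w z₀ ≤ w (z n) := by linarith [ih.2]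
      rw [hsucc]
      refine ⟨hfΩ _ ih.1 h1, ?_⟩
      have := hfw _ ih.1 h1
      push_cast
      linarith [ih.2]
  have hle : ∀ n : ℕ, w z₀ ≤ w (z n) := fun n => by
    have h0 : 0 ≤ k * n := by positivity
    linarith [(hzn n).2]
  have hdist : ∀ n, dist (z (n + 1)) (z n) ≤ infDist (z n) (frontier Ω) / 4 := fun n => by
    rw [hsucc]; exact hfd _ (hzn n).1 (hle n)
  have hsegball : ∀ n, segment ℝ (z n) (z (n + 1)) ⊆
      closedBall (z n) (infDist (z n) (frontier Ω) / 4) := fun n =>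
    (convex_closedBall _ _).segment_subset
      (mem_closedBall_self (by have := hpos _ (hzn n).1; positivity)) (hdist n)
  have hsegΩ : ∀ n, segment ℝ (z n) (z (n + 1)) ⊆ Ω := fun n =>
    ((hsegball n).trans (closedBall_subset_ball (by have := hpos _ (hzn n).1; linarith))).trans
      (ball_infDist_frontier_subset (hzn n).1)
  set q := Real.exp (-(k / 3)) with hq
  set C := Real.exp (-((w z₀ - 1) / 3)) with hC
  have hq1 : q < 1 := by rw [hq, Real.exp_lt_one_iff]; linarith
  have hq0 : 0 ≤ q := (Real.exp_pos _).le
  have hbound : ∀ n, ∀ x ∈ segment ℝ (z n) (z (n + 1)),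
      Real.exp (u x) * (infDist (z n) (frontier Ω) / 4) ≤ C * q ^ n := by
    intro n x hx
    refine (exp_mul_infDist_frontier_le_of_boundaryDefect hopen hr hpos hu heq (hzn n).1
      (hsegball n hx)).trans ?_
    rw [hC, hq, ← Real.exp_nat_mul, ← Real.exp_add, Real.exp_le_exp]
    have := (hzn n).2
    rw [← hw]
    linarith
  refine hcomp.false_of_summable_polygon (C := C) hq0 hq1 hsegΩ
    (fun n x hx => ?_) (fun K hKΩ hK => ?_)
  · refine le_trans ?_ (hbound n x hx)
    rw [← dist_eq_norm]
    gcongr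
    exact hdist n
  · rcases K.eq_empty_or_nonempty with rfl | hKne
    · exact ⟨0, fun n _ => disjoint_empty _⟩
    obtain ⟨p, hp, hmin⟩ := hK.exists_isMinOn hKne
      (f := fun x => Real.exp (u x) * infDist x (frontier Ω))
      ((Real.continuous_exp.comp_continuousOn (hu.continuousOn.mono hKΩ)).mul
        (continuous_infDist_pt _).continuousOn)
    have hb : 0 < Real.exp (u p) * infDist p (frontier Ω) :=
      mul_pos (Real.exp_pos _) (hpos p (hKΩ hp))
    have htend : Tendsto (fun n : ℕ => 5 * (C * q ^ n)) atTop (𝓝 0) := by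
      simpa using ((tendsto_pow_atTop_nhds_zero_of_lt_one hq0 hq1).const_mul C).const_mul 5
    obtain ⟨N, hN⟩ := eventually_atTop.1 (htend.eventually_lt_const hb)
    refine ⟨N, fun n hn => disjoint_left.2 fun x hx hxK => ?_⟩
    have h1 := hN n hn
    have h2 : Real.exp (u p) * infDist p (frontier Ω) ≤ Real.exp (u x) * infDist x (frontier Ω) :=
      hmin hxK
    have h3 := (infDist_le_add_of_mem_closedBall (s := frontier Ω) (hsegball n hx)).1
    have h4 := hbound n x hx
    have h5 := mul_le_mul_of_nonneg_left h3 (Real.exp_pos (u x)).le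
    linarith

theorem le_infDist_mul_exp_of_boundaryDefect_nonpos (hr : 0 < r) {x : ℂ}
    (hpos : 0 < infDist x (frontier Ω)) (h : boundaryDefect Ω r u x ≤ 0) :
    2 * r / (2 * r + infDist x (frontier Ω)) ≤ infDist x (frontier Ω) * Real.exp (u x) := by
  rw [boundaryDefect, ← Real.log_div (by positivity) (by positivity), sub_nonpos,
    Real.log_le_iff_le_exp (by positivity), div_le_iff₀ (by positivity)] at h
  rw [div_le_iff₀ (by positivity)]
  linarith

theorem exists_tangent_disks (hr : 0 < r) (hfr : (frontier Ω).Nonempty)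
    (hpos : ∀ z ∈ Ω, 0 < infDist z (frontier Ω))
    (hdisks : ∀ p ∈ frontier Ω, ∃ cin cout : ℂ,
      dist p cin = r ∧ closedBall cin r ⊆ closure Ω ∧ dist p cout = r ∧ closedBall cout r ⊆ Ωᶜ)
    {p : ℂ} (hp : p ∈ Ω) :
    ∃ cin cout : ℂ, ball cin r ⊆ Ω ∧ dist p cin = |infDist p (frontier Ω) - r| ∧
      closedBall cout r ⊆ Ωᶜ ∧ dist p cout = r + infDist p (frontier Ω) := by
  obtain ⟨q, hq, hpq⟩ := isClosed_frontier.exists_infDist_eq_dist hfr p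
  obtain ⟨cin, cout, hqin, hin, hqout, hout⟩ := hdisks q hq
  have hball : ball cin r ⊆ Ω := ball_subset_of_exterior_disks hr
    (fun p hp => (hdisks p hp).elim fun _ ⟨c, _, _, h⟩ => ⟨c, h⟩) hin
  have hcc : r + r ≤ dist cin cout := by
    rw [← disjoint_ball_ball_iff hr hr]
    exact (disjoint_compl_right.mono_left hball).mono_right (ball_subset_closedBall.trans hout)
  obtain ⟨h1, h2⟩ := norm_sub_eq_of_tangent_disks hpq.symm hqin hqout
    (add_infDist_frontier_le_dist hr hp (hpos p hp) hout) hcc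
  exact ⟨cin, cout, hball, h1, hout, h2⟩

theorem infDist_mul_exp_le_of_tangent_disk (hopen : IsOpen Ω) (hu : ContDiffOn ℝ 2 u Ω)
    (heq : ∀ z ∈ Ω, Δ u z = Real.exp (2 * u z)) {p c : ℂ} {d : ℝ} (hd : 0 < d) (hdr : d ≤ r)
    (hc : ball c r ⊆ Ω) (hpc : dist p c = |d - r|) :
    d * Real.exp (u p) ≤ 2 * r / (2 * r - d) := by
  rw [abs_of_nonpos (by linarith)] at hpc
  have h := exp_mul_le_of_laplacian_eq hopen hu heq hc (x := p) (by rw [mem_ball]; linarith)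
  rw [← dist_eq_norm, hpc] at h
  rw [le_div_iff₀ (by linarith)]
  linarith

end

/-- If `Ω ⊆ ℂ` is bounded, open and connected, satisfies a uniform interior and
exterior disk condition of radius `r` at every boundary point, and `u` is a complete
C² solution of `Δu = e^{2u}` on `Ω`, then `δ(p)²·e^{2u(p)} → 1` as `p → ∂Ω`, where
`δ(p) = dist(p, ∂Ω)`. -/
theorem boundary_asymptotics_of_poincare_factor
    (Ω : Set ℂ) (hbdd : Bornology.IsBounded Ω) (hopen : IsOpen Ω)
    (hconn : IsConnected Ω) (r : ℝ) (hr : 0 < r)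
    (hdisks : ∀ p ∈ frontier Ω, ∃ cin cout : ℂ,
      dist p cin = r ∧ Metric.closedBall cin r ⊆ closure Ω ∧
      dist p cout = r ∧ Metric.closedBall cout r ⊆ Ωᶜ)
    (u : ℂ → ℝ) (hu : ContDiffOn ℝ 2 u Ω)
    (heq : ∀ z ∈ Ω, laplacianOn u Ω z = Real.exp (2 * u z))
    (hcomp : ConformallyComplete u Ω) :
    ∀ ε > (0 : ℝ), ∃ η > (0 : ℝ), ∀ p ∈ Ω,
      Metric.infDist p (frontier Ω) < η →
      |(Metric.infDist p (frontier Ω)) ^ 2 * Real.exp (2 * u p) - 1| < ε := by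
  have hfr : (frontier Ω).Nonempty := by
    refine nonempty_frontier_iff.2 ⟨hconn.nonempty, ?_⟩
    rintro rfl
    exact NormedSpace.unbounded_univ ℝ ℂ hbdd
  have hpos : ∀ z ∈ Ω, 0 < Metric.infDist z (frontier Ω) := fun z hz =>
    (isClosed_frontier.notMem_iff_infDist_pos hfr).1 fun h => by
      rw [hopen.frontier_eq] at h; exact h.2 hz
  have hD : ∀ z ∈ Ω, Metric.infDist z (frontier Ω) ≤ Metric.diam (closure Ω) := by
    obtain ⟨q, hq⟩ := hfr
    exact fun z hz => (Metric.infDist_le_dist_of_mem hq).trans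
      (Metric.dist_le_diam_of_mem hbdd.closure (subset_closure hz) (frontier_subset_closure hq))
  have heq' : ∀ z ∈ Ω, Laplacian.laplacian u z = Real.exp (2 * u z) := fun z hz => by
    rw [← laplacianOn_eq_laplacian hopen hz, heq z hz]
  have htan := fun p (hp : p ∈ Ω) => exists_tangent_disks hr hfr hpos hdisks hp
  have hlim : ∀ s : ℝ, Filter.Tendsto (fun d : ℝ => (2 * r / (2 * r + s * d)) ^ 2)
      (nhds 0) (nhds 1) := fun s => by
    have : ContinuousAt (fun d : ℝ => (2 * r / (2 * r + s * d)) ^ 2) 0 := by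
      have : 2 * r + s * 0 ≠ 0 := by simpa using hr.ne'
      fun_prop (disch := assumption)
    simpa [ContinuousAt, hr.ne'] using this
  intro ε hε
  obtain ⟨η, hη, hηs⟩ := Metric.eventually_nhds_iff.1
    (((hlim 1).eventually_const_lt (show 1 - ε < 1 by linarith)).and
      ((hlim (-1)).eventually_lt_const (show 1 < 1 + ε by linarith)))
  refine ⟨min η r, lt_min hη hr, fun p hp hpd => ?_⟩
  have hdpos := hpos p hp
  set d := Metric.infDist p (frontier Ω) with hd
  obtain ⟨cin, cout, hin, hpin, -⟩ := htan p hp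
  have hdr : d < r := hpd.trans_le (min_le_right _ _)
  have hup := infDist_mul_exp_le_of_tangent_disk hopen hu heq' hdpos hdr.le hin hpin
  have hlow := le_infDist_mul_exp_of_boundaryDefect_nonpos hr hdpos
    (boundaryDefect_nonpos hopen hr hpos hD
      (fun z hz => (htan z hz).elim fun _ ⟨c, _, _, h1, h2⟩ => ⟨c, h2, h1⟩) hu heq' hcomp hp)
  rw [← hd] at hlow
  have hnear := hηs (y := d) (by
    rw [Real.dist_0_eq_abs, abs_of_pos hdpos]; exact hpd.trans_le (min_le_left _ _))
  rw [one_mul, neg_one_mul, ← sub_eq_add_neg] at hnear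
  have hsq : d ^ 2 * Real.exp (2 * u p) = (d * Real.exp (u p)) ^ 2 := by
    rw [mul_pow, ← Real.exp_nat_mul]; norm_num
  have h1 : (2 * r / (2 * r + d)) ^ 2 ≤ (d * Real.exp (u p)) ^ 2 := by gcongr
  have h2 : (d * Real.exp (u p)) ^ 2 ≤ (2 * r / (2 * r - d)) ^ 2 := by gcongr
  rw [hsq, abs_lt]
  constructor <;> linarith [hnear.1, hnear.2]
end
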